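/- arXiv:1810.10128 — 2 statements merged into one kernel-verified Lean document; each statement's English description precedes it below -/
import Mathlib

section
/- Let f : (-1,1) → ℝ be measurable with f(x)·(1-x²)^{1/4} ∈ L²(-1,1), and suppose ∫_{-1}^{1} f(x) dx = 0 (i.e., f(x)√(1-x²) has mean value 0 with respect to the arcsine measure dx/(π√(1-x²))). Then ∫_{-1}^{1} (Hf)(x)² √(1-x²) dx = ∫_{-1}^{1} f(x)² √(1-x²) dx, where H denotes the finite Hilbert transform. -/
open MeasureTheory Filter Set Real

/-- The truncated finite Hilbert transform of `f` on `(-1,1)` at `x`. -/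
noncomputable def truncatedFiniteHilbert (f : ℝ → ℝ) (x ε : ℝ) : ℝ :=
  (1 / π) * ∫ y in Ioo (-1 : ℝ) 1 \ Ioo (x - ε) (x + ε), f y / (x - y)

/-- `L` is the value of the finite Hilbert transform at `x`, as a limit as `ε → 0⁺`. -/
def HasFiniteHilbertAt (f : ℝ → ℝ) (x L : ℝ) : Prop :=
  Tendsto (fun ε => truncatedFiniteHilbert f x ε) (nhdsWithin 0 (Ioi 0)) (nhds L)

theorem hasDerivAt_sq_div_one_add_sq (s : ℝ) :
    HasDerivAt (fun s : ℝ => s ^ 2 / (1 + s ^ 2)) (2 * s / (1 + s ^ 2) ^ 2) s := by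
  have h : (1 + s ^ 2) ≠ 0 := by positivity
  refine HasDerivAt.congr_deriv
    ((hasDerivAt_pow 2 s).fun_div ((hasDerivAt_pow 2 s).const_add 1) h) ?_
  field_simp
  ring

theorem tendsto_sq_div_one_add_sq_atTop :
    Tendsto (fun s : ℝ => s ^ 2 / (1 + s ^ 2)) atTop (nhds 1) := by
  have h : Tendsto (fun s : ℝ => 1 - (1 + s ^ 2)⁻¹) atTop (nhds (1 - 0)) :=
    tendsto_const_nhds.sub (tendsto_inv_atTop_zero.comp
      (tendsto_atTop_add_const_left _ _ (tendsto_pow_atTop two_ne_zero)))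
  rw [sub_zero] at h
  refine h.congr fun s => ?_
  have h : (1 + s ^ 2) ≠ 0 := by positivity
  field_simp
  ring

theorem integrableOn_Ioi_two_mul_div_one_add_sq_sq :
    IntegrableOn (fun s : ℝ => 2 * s / (1 + s ^ 2) ^ 2) (Ioi 0) :=
  integrableOn_Ioi_deriv_of_nonneg' (fun s _ => hasDerivAt_sq_div_one_add_sq s)
    (fun s hs => by have : (0 : ℝ) < s := hs; positivity) tendsto_sq_div_one_add_sq_atTop

theorem integral_Ioi_two_mul_div_one_add_sq_sq :
    ∫ s in Ioi (0 : ℝ), 2 * s / (1 + s ^ 2) ^ 2 = 1 := by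
  rw [integral_Ioi_of_hasDerivAt_of_nonneg' (fun s _ => hasDerivAt_sq_div_one_add_sq s)
    (fun s hs => by have : (0 : ℝ) < s := hs; positivity) tendsto_sq_div_one_add_sq_atTop]
  simp

theorem integral_Ioi_indicator_two_mul_div_one_add_sq_sq {u y : ℝ} (hu : 0 ≤ u) (hy : 0 < y) :
    ∫ s in Ioi (0 : ℝ), (if y * s ≤ u then 2 * s / (1 + s ^ 2) ^ 2 else 0)
      = u ^ 2 / (u ^ 2 + y ^ 2) := by
  have h1 : ∀ s : ℝ, (if y * s ≤ u then 2 * s / (1 + s ^ 2) ^ 2 else 0)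
      = (Iic (u / y)).indicator (fun s : ℝ => 2 * s / (1 + s ^ 2) ^ 2) s := by
    intro s
    simp only [indicator, mem_Iic, le_div_iff₀ hy, mul_comm]
  simp_rw [h1]
  rw [setIntegral_indicator measurableSet_Iic, Ioi_inter_Iic,
    ← intervalIntegral.integral_of_le (by positivity),
    intervalIntegral.integral_eq_sub_of_hasDerivAt
      (fun s _ => hasDerivAt_sq_div_one_add_sq s)]
  · have : u ^ 2 + y ^ 2 ≠ 0 := by positivity
    have : y ^ 2 + u ^ 2 ≠ 0 := by positivity
    field_simp
    ring
  · rw [intervalIntegrable_iff_integrableOn_Ioc_of_le (by positivity)]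
    exact integrableOn_Ioi_two_mul_div_one_add_sq_sq.mono_set Ioc_subset_Ioi_self

theorem truncatedFiniteHilbert_eq_integral_ite (f : ℝ → ℝ) (x ε : ℝ) :
    truncatedFiniteHilbert f x ε
      = (1 / π) * ∫ t in Ioo (-1 : ℝ) 1, (if ε ≤ |x - t| then f t / (x - t) else 0) := by
  have h1 : ∀ t : ℝ, (if ε ≤ |x - t| then f t / (x - t) else 0)
      = ((Ioo (x - ε) (x + ε))ᶜ).indicator (fun t : ℝ => f t / (x - t)) t := by
    intro t
    have : t ∈ (Ioo (x - ε) (x + ε))ᶜ ↔ ε ≤ |x - t| := by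
      rw [mem_compl_iff, mem_Ioo, ← not_lt, not_iff_not, abs_lt]
      constructor <;> rintro ⟨h1, h2⟩ <;> constructor <;> linarith
    simp only [indicator, this]
  simp_rw [h1]
  rw [truncatedFiniteHilbert, setIntegral_indicator measurableSet_Ioo.compl, sdiff_eq]

theorem abs_truncatedFiniteHilbert_le {f : ℝ → ℝ} (hf : IntegrableOn f (Ioo (-1 : ℝ) 1))
    (x : ℝ) {δ ε : ℝ} (hδ : 0 < δ) (hε : δ ≤ ε) :
    |truncatedFiniteHilbert f x ε| ≤ (1 / π) * ∫ t in Ioo (-1 : ℝ) 1, |f t| / δ := by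
  rw [truncatedFiniteHilbert_eq_integral_ite, abs_mul, abs_of_pos (by positivity)]
  gcongr
  rw [← Real.norm_eq_abs]
  refine norm_integral_le_of_norm_le (hf.abs.div_const δ) (ae_of_all _ fun t => ?_)
  split_ifs with h
  · rw [norm_div, Real.norm_eq_abs, Real.norm_eq_abs]
    gcongr
    exact hε.trans h
  · simp only [norm_zero]
    positivity

theorem integrable_prod_ite_mul_div {f : ℝ → ℝ} (hf : IntegrableOn f (Ioo (-1 : ℝ) 1))
    (x : ℝ) {y : ℝ} (hy : 0 < y) :
    Integrable (fun p : ℝ × ℝ =>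
        (if y * p.1 ≤ |x - p.2| then 2 * p.1 / (1 + p.1 ^ 2) ^ 2 else 0) * (f p.2 / (x - p.2)))
      ((volume.restrict (Ioi 0)).prod (volume.restrict (Ioo (-1 : ℝ) 1))) := by
  have hmeas : AEStronglyMeasurable (fun p : ℝ × ℝ =>
        (if y * p.1 ≤ |x - p.2| then 2 * p.1 / (1 + p.1 ^ 2) ^ 2 else 0) * (f p.2 / (x - p.2)))
      ((volume.restrict (Ioi 0)).prod (volume.restrict (Ioo (-1 : ℝ) 1))) := by
    refine AEStronglyMeasurable.mul (Measurable.aestronglyMeasurable ?_) ?_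
    · exact Measurable.ite (measurableSet_le (by fun_prop) (by fun_prop)) (by fun_prop)
        measurable_const
    · refine (AEMeasurable.div ?_ (by fun_prop)).aestronglyMeasurable
      exact hf.aestronglyMeasurable.comp_snd.aemeasurable
  rw [integrable_prod_iff' hmeas]
  constructor
  · refine ae_of_all _ fun t => ?_
    simp only
    refine Integrable.mul_const ?_ _
    refine Integrable.mono' integrableOn_Ioi_two_mul_div_one_add_sq_sq
      (Measurable.aestronglyMeasurable ?_) ?_
    · exact Measurable.ite (measurableSet_le (by fun_prop) (by fun_prop)) (by fun_prop)
        measurable_const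
    · filter_upwards [ae_restrict_mem measurableSet_Ioi] with s hs
      have : (0 : ℝ) < s := hs
      split_ifs
      · rw [Real.norm_of_nonneg (by positivity)]
      · rw [norm_zero]; positivity
  · have h : ∀ t : ℝ, ∫ s in Ioi (0 : ℝ),
        ‖(if y * s ≤ |x - t| then 2 * s / (1 + s ^ 2) ^ 2 else 0) * (f t / (x - t))‖
          = |x - t| ^ 2 / (|x - t| ^ 2 + y ^ 2) * |f t / (x - t)| := by
      intro t
      rw [← integral_Ioi_indicator_two_mul_div_one_add_sq_sq (abs_nonneg (x - t)) hy,
        ← integral_mul_const]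
      refine setIntegral_congr_fun measurableSet_Ioi fun s hs => ?_
      have : (0 : ℝ) < s := hs
      simp only [norm_mul, Real.norm_eq_abs]
      congr 1
      split_ifs
      · rw [abs_of_nonneg (by positivity)]
      · simp
    simp only [h]
    refine Integrable.mono' (hf.abs.const_mul (1 / y)) ?_ (ae_of_all _ fun t => ?_)
    · refine AEStronglyMeasurable.mul (Measurable.aestronglyMeasurable (by fun_prop)) ?_
      exact ((hf.aestronglyMeasurable.aemeasurable.div (by fun_prop)).abs).aestronglyMeasurable
    · rw [Real.norm_of_nonneg (by positivity), abs_div]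
      rcases eq_or_lt_of_le (abs_nonneg (x - t)) with h0 | h0
      · rw [← h0]; simp; positivity
      · rw [show |x - t| ^ 2 / (|x - t| ^ 2 + y ^ 2) * (|f t| / |x - t|)
          = |x - t| / (|x - t| ^ 2 + y ^ 2) * |f t| by field_simp]
        gcongr ?_ * _
        rw [div_le_div_iff₀ (by positivity) hy]
        nlinarith [sq_nonneg (|x - t| - y)]

theorem two_mul_div_mul_truncatedFiniteHilbert (f : ℝ → ℝ) (x y s : ℝ) :
    2 * s / (1 + s ^ 2) ^ 2 * truncatedFiniteHilbert f x (y * s)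
      = (1 / π) * ∫ t in Ioo (-1 : ℝ) 1,
        (if y * s ≤ |x - t| then 2 * s / (1 + s ^ 2) ^ 2 else 0) * (f t / (x - t)) := by
  rw [truncatedFiniteHilbert_eq_integral_ite, mul_left_comm, ← integral_const_mul]
  congr 2
  ext t
  split_ifs <;> simp

theorem integral_mul_truncatedFiniteHilbert {f : ℝ → ℝ} (hf : IntegrableOn f (Ioo (-1 : ℝ) 1))
    (x : ℝ) {y : ℝ} (hy : 0 < y) :
    ∫ s in Ioi (0 : ℝ), 2 * s / (1 + s ^ 2) ^ 2 * truncatedFiniteHilbert f x (y * s)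
      = (1 / π) * ∫ t in Ioo (-1 : ℝ) 1, f t * ((x - t) / ((x - t) ^ 2 + y ^ 2)) := by
  simp_rw [two_mul_div_mul_truncatedFiniteHilbert]
  rw [integral_const_mul, integral_integral_swap (integrable_prod_ite_mul_div hf x hy)]
  congr 2
  ext t
  rw [integral_mul_const, integral_Ioi_indicator_two_mul_div_one_add_sq_sq (abs_nonneg _) hy,
    sq_abs]
  rcases eq_or_ne (x - t) 0 with h0 | h0
  · simp [h0]
  · have : (x - t) ^ 2 + y ^ 2 ≠ 0 := by positivity
    field_simp

theorem HasFiniteHilbertAt.exists_bound {f : ℝ → ℝ} {x L : ℝ}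
    (hf : IntegrableOn f (Ioo (-1 : ℝ) 1)) (h : HasFiniteHilbertAt f x L) :
    ∃ M, ∀ ε, 0 < ε → |truncatedFiniteHilbert f x ε| ≤ M := by
  have h1 : ∀ᶠ ε in nhdsWithin 0 (Ioi 0), |truncatedFiniteHilbert f x ε| < |L| + 1 :=
    (h.abs).eventually_lt_const (by linarith)
  obtain ⟨δ, hδ, hsub⟩ := mem_nhdsGT_iff_exists_Ioo_subset.1 h1
  have hδ' : (0 : ℝ) < δ := hδ
  refine ⟨max (|L| + 1) ((1 / π) * ∫ t in Ioo (-1 : ℝ) 1, |f t| / δ), fun ε hε => ?_⟩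
  rcases lt_or_ge ε δ with hlt | hge
  · exact le_max_of_le_left (le_of_lt (hsub ⟨hε, hlt⟩))
  · exact le_max_of_le_right (abs_truncatedFiniteHilbert_le hf x hδ' hge)

/-- Existence of the principal value forces convergence of the conjugate Poisson integrals, as
these are averages of the truncated transforms. -/
theorem HasFiniteHilbertAt.tendsto_conjugatePoisson {f : ℝ → ℝ} {x L : ℝ}
    (hf : IntegrableOn f (Ioo (-1 : ℝ) 1)) (h : HasFiniteHilbertAt f x L) :
    Tendsto (fun y => (1 / π) * ∫ t in Ioo (-1 : ℝ) 1, f t * ((x - t) / ((x - t) ^ 2 + y ^ 2)))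
      (nhdsWithin 0 (Ioi 0)) (nhds L) := by
  obtain ⟨M, hM⟩ := h.exists_bound hf
  have key : Tendsto (fun y : ℝ => ∫ s in Ioi (0 : ℝ),
      2 * s / (1 + s ^ 2) ^ 2 * truncatedFiniteHilbert f x (y * s))
      (nhdsWithin 0 (Ioi 0)) (nhds (∫ s in Ioi (0 : ℝ), 2 * s / (1 + s ^ 2) ^ 2 * L)) := by
    refine tendsto_integral_filter_of_dominated_convergence
      (fun s => 2 * s / (1 + s ^ 2) ^ 2 * M) ?_ ?_
      (integrableOn_Ioi_two_mul_div_one_add_sq_sq.mul_const M) ?_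
    · filter_upwards [self_mem_nhdsWithin] with y hy
      have := (integrable_prod_ite_mul_div hf x hy).aestronglyMeasurable.integral_prod_right'
      refine (this.const_mul (1 / π)).congr (ae_of_all _ fun s => ?_)
      simp only [two_mul_div_mul_truncatedFiniteHilbert]
    · filter_upwards [self_mem_nhdsWithin] with y hy
      filter_upwards [ae_restrict_mem measurableSet_Ioi] with s hs
      have hs' : (0 : ℝ) < s := hs
      have hy' : (0 : ℝ) < y := hy
      rw [norm_mul, Real.norm_of_nonneg (by positivity)]
      gcongr
      exact hM _ (by positivity)
    · filter_upwards [ae_restrict_mem measurableSet_Ioi] with s hs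
      have hs' : (0 : ℝ) < s := hs
      suffices hlim : Tendsto (fun y : ℝ => y * s) (nhdsWithin 0 (Ioi 0))
          (nhdsWithin 0 (Ioi 0)) from (Tendsto.comp h hlim).const_mul _
      refine tendsto_nhdsWithin_iff.2 ⟨?_, ?_⟩
      · have : Tendsto (fun y : ℝ => y * s) (nhds 0) (nhds (0 * s)) :=
          (continuous_id.mul continuous_const).tendsto 0
        rw [zero_mul] at this
        exact this.mono_left nhdsWithin_le_nhds
      · filter_upwards [self_mem_nhdsWithin] with y hy
        exact mul_pos hy hs'
  rw [integral_mul_const, integral_Ioi_two_mul_div_one_add_sq_sq, one_mul] at key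
  refine key.congr' ?_
  filter_upwards [self_mem_nhdsWithin] with y hy
  exact integral_mul_truncatedFiniteHilbert hf x hy

theorem integrableOn_ofReal_mul_inv_sub {f : ℝ → ℝ} (hf : IntegrableOn f (Ioo (-1 : ℝ) 1))
    {z : ℂ} (hz : z.im ≠ 0) :
    IntegrableOn (fun t : ℝ => (f t : ℂ) * (z - t)⁻¹) (Ioo (-1 : ℝ) 1) := by
  refine Integrable.mul_bdd (c := |z.im|⁻¹) hf.ofReal
    (Measurable.aestronglyMeasurable (by fun_prop)) (ae_of_all _ fun t => ?_)
  rw [norm_inv]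
  have : |z.im| ≤ ‖z - t‖ := by simpa using Complex.abs_im_le_norm (z - t)
  gcongr

theorem re_integral_ofReal_mul_inv_sub {f : ℝ → ℝ} (hf : IntegrableOn f (Ioo (-1 : ℝ) 1))
    {z : ℂ} (hz : z.im ≠ 0) :
    (∫ t in Ioo (-1 : ℝ) 1, (f t : ℂ) * (z - t)⁻¹).re
      = ∫ t in Ioo (-1 : ℝ) 1, f t * ((z.re - t) / ((z.re - t) ^ 2 + z.im ^ 2)) := by
  have h := Complex.reCLM.integral_comp_comm (integrableOn_ofReal_mul_inv_sub hf hz)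
  simp only [Complex.reCLM_apply] at h
  rw [← h]
  congr 1
  ext t
  simp [Complex.inv_re, Complex.normSq_apply, sq]

/-- Where the principal value exists, the Cauchy integral has it as boundary value of its real
part, along any curve tangent to the normal direction. -/
theorem HasFiniteHilbertAt.tendsto_re_cauchyIntegral {f : ℝ → ℝ} {x L C : ℝ}
    (hf : IntegrableOn f (Ioo (-1 : ℝ) 1)) (h : HasFiniteHilbertAt f x L) {z : ℕ → ℂ}
    (hz : Tendsto z atTop (nhds (x : ℂ))) (hz0 : ∀ k, (z k).im ≠ 0)
    (hC : ∀ k, |(z k).re - x| ≤ C * (z k).im ^ 2) :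
    Tendsto (fun k => (1 / π) * (∫ t in Ioo (-1 : ℝ) 1, (f t : ℂ) * (z k - t)⁻¹).re)
      atTop (nhds L) := by
  set p : ℕ → ℂ := fun k => ⟨x, (z k).im⟩ with hp
  have him : Tendsto (fun k => (z k).im) atTop (nhds 0) := by
    have := (Complex.continuous_im.tendsto _).comp hz
    rwa [Complex.ofReal_im] at this
  have hpx : Tendsto p atTop (nhds (x : ℂ)) := by
    have : Tendsto (fun k => (x : ℂ) + (z k).im * Complex.I) atTop
        (nhds ((x : ℂ) + ((0 : ℝ) : ℂ) * Complex.I)) :=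
      (((Complex.continuous_ofReal.tendsto _).comp him).mul_const _).const_add _
    simp only [Complex.ofReal_zero, zero_mul, add_zero] at this
    refine this.congr fun k => ?_
    apply Complex.ext <;> simp [hp]
  have hzt : ∀ k (t : ℝ), |(z k).im| ≤ ‖z k - t‖ := fun k t => by
    simpa using Complex.abs_im_le_norm (z k - t)
  have hpt : ∀ k (t : ℝ), |(z k).im| ≤ ‖p k - t‖ := fun k t => by
    simpa [hp] using Complex.abs_im_le_norm (p k - t)
  have hzp : ∀ k, ‖p k - z k‖ ≤ C * (z k).im ^ 2 := fun k => by
    have : p k - z k = ((x - (z k).re : ℝ) : ℂ) := by apply Complex.ext <;> simp [hp]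
    rw [this, Complex.norm_real, Real.norm_eq_abs, abs_sub_comm]
    exact hC k
  have hdiff : Tendsto (fun k => ∫ t in Ioo (-1 : ℝ) 1,
      ((f t : ℂ) * (z k - t)⁻¹ - (f t : ℂ) * (p k - t)⁻¹)) atTop
      (nhds (∫ t in Ioo (-1 : ℝ) 1, (0 : ℂ))) := by
    refine tendsto_integral_of_dominated_convergence (fun t => |f t| * C) ?_
      (hf.abs.mul_const C) ?_ ?_
    · exact fun k => ((integrableOn_ofReal_mul_inv_sub hf (hz0 k)).sub
        (integrableOn_ofReal_mul_inv_sub hf (z := p k) (hz0 k))).aestronglyMeasurable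
    · refine fun k => ae_of_all _ fun t => ?_
      have hpos : 0 < |(z k).im| := abs_pos.2 (hz0 k)
      have h1 : z k - t ≠ 0 := norm_pos_iff.1 (hpos.trans_le (hzt k t))
      have h2 : p k - t ≠ 0 := norm_pos_iff.1 (hpos.trans_le (hpt k t))
      rw [← mul_sub, norm_mul, Complex.norm_real, Real.norm_eq_abs, inv_sub_inv h1 h2,
        sub_sub_sub_cancel_right, norm_div, norm_mul]
      gcongr
      rw [div_le_iff₀ (mul_pos (norm_pos_iff.2 h1) (norm_pos_iff.2 h2))]
      have hC0 : 0 ≤ C := by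
        have := (abs_nonneg _).trans (hC k)
        exact nonneg_of_mul_nonneg_left this (by have := hz0 k; positivity)
      refine (hzp k).trans ?_
      rw [← sq_abs, sq]
      gcongr
      · exact hzt k t
      · exact hpt k t
    · have hne : ∀ᵐ t ∂(volume.restrict (Ioo (-1 : ℝ) 1)), t ≠ x :=
        ae_restrict_of_ae (Measure.ae_ne volume x)
      filter_upwards [hne] with t ht
      have hxt : (x : ℂ) - t ≠ 0 := by
        rw [sub_ne_zero]; exact_mod_cast ht.symm
      have h1 := (((hz.sub_const (t : ℂ)).inv₀ hxt).const_mul (f t : ℂ)).sub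
        (((hpx.sub_const (t : ℂ)).inv₀ hxt).const_mul (f t : ℂ))
      rwa [sub_self] at h1
  have hQ : Tendsto (fun k => (1 / π) * (∫ t in Ioo (-1 : ℝ) 1, (f t : ℂ) * (p k - t)⁻¹).re)
      atTop (nhds L) := by
    have hy : Tendsto (fun k => |(z k).im|) atTop (nhdsWithin 0 (Ioi 0)) := by
      refine tendsto_nhdsWithin_iff.2 ⟨by simpa using him.abs, Eventually.of_forall fun k => ?_⟩
      exact abs_pos.2 (hz0 k)
    refine ((h.tendsto_conjugatePoisson hf).comp hy).congr fun k => ?_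
    rw [re_integral_ofReal_mul_inv_sub hf (z := p k) (hz0 k)]
    simp [hp]
  have hre := ((Complex.continuous_re.tendsto _).comp hdiff).const_mul (1 / π)
  have hsum := hre.add hQ
  simp only [integral_zero, Complex.zero_re, mul_zero, zero_add] at hsum
  refine hsum.congr fun k => ?_
  simp only [Function.comp_apply]
  rw [integral_sub (integrableOn_ofReal_mul_inv_sub hf (hz0 k))
    (integrableOn_ofReal_mul_inv_sub hf (z := p k) (hz0 k)), Complex.sub_re]
  ring

instance fact_zero_lt_two_pi : Fact (0 < 2 * π) := ⟨Real.two_pi_pos⟩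

/-- The cosine function on the circle `ℝ / 2πℤ`. -/
noncomputable def circleCos (x : AddCircle (2 * π)) : ℝ := (fourier 1 x).re

/-- The sine function on the circle `ℝ / 2πℤ`. -/
noncomputable def circleSin (x : AddCircle (2 * π)) : ℝ := (fourier 1 x).im

theorem continuous_circleCos : Continuous circleCos :=
  Complex.continuous_re.comp (map_continuous _)

theorem continuous_circleSin : Continuous circleSin :=
  Complex.continuous_im.comp (map_continuous _)

theorem fourier_one_coe (θ : ℝ) :
    fourier 1 (θ : AddCircle (2 * π)) = Complex.exp (θ * Complex.I) := by
  rw [fourier_coe_apply]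
  congr 1
  have : (π : ℂ) ≠ 0 := by exact_mod_cast Real.pi_ne_zero
  push_cast
  field_simp

theorem circleCos_coe (θ : ℝ) : circleCos (θ : AddCircle (2 * π)) = Real.cos θ := by
  rw [circleCos, fourier_one_coe, Complex.exp_ofReal_mul_I_re]

theorem circleSin_coe (θ : ℝ) : circleSin (θ : AddCircle (2 * π)) = Real.sin θ := by
  rw [circleSin, fourier_one_coe, Complex.exp_ofReal_mul_I_im]

theorem circleCos_sq_add_circleSin_sq (x : AddCircle (2 * π)) :
    circleCos x ^ 2 + circleSin x ^ 2 = 1 := by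
  induction x using QuotientAddGroup.induction_on with
  | H θ => rw [circleCos_coe, circleSin_coe, Real.cos_sq_add_sin_sq]

theorem lintegral_Ioc_cos_mul_abs_sin (F : ℝ → ENNReal) :
    ∫⁻ θ in Ioc 0 π, ENNReal.ofReal |Real.sin θ| * F (Real.cos θ)
      = ∫⁻ x in Ioo (-1 : ℝ) 1, F x := by
  have h := lintegral_image_eq_lintegral_abs_deriv_mul (measurableSet_Icc (a := 0) (b := π))
    (fun θ _ => (Real.hasDerivAt_cos θ).hasDerivWithinAt) Real.injOn_cos F
  rw [Real.bijOn_cos.image_eq] at h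
  simp only [abs_neg] at h
  rw [setLIntegral_congr Ioc_ae_eq_Icc, ← h, setLIntegral_congr Ioo_ae_eq_Icc]

theorem lintegral_Ioc_neg_cos_mul_abs_sin (F : ℝ → ENNReal) :
    ∫⁻ θ in Ioc (-π) 0, ENNReal.ofReal |Real.sin θ| * F (Real.cos θ)
      = ∫⁻ x in Ioo (-1 : ℝ) 1, F x := by
  rw [← lintegral_Ioc_cos_mul_abs_sin, setLIntegral_congr Ioc_ae_eq_Icc,
    setLIntegral_congr (Ioc_ae_eq_Icc (a := (0 : ℝ)))]
  have h := (Measure.measurePreserving_neg (volume : Measure ℝ)).setLIntegral_comp_preimage_emb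
    (MeasurableEquiv.neg ℝ).measurableEmbedding
    (fun θ => ENNReal.ofReal |Real.sin θ| * F (Real.cos θ)) (Icc 0 π)
  simpa using h

theorem lintegral_haarAddCircle_circleCos (F : ℝ → ENNReal) :
    ∫⁻ x, ENNReal.ofReal |circleSin x| * F (circleCos x)
        ∂(AddCircle.haarAddCircle (T := 2 * π))
      = ENNReal.ofReal (1 / π) * ∫⁻ x in Ioo (-1 : ℝ) 1, F x := by
  have h := AddCircle.lintegral_preimage (2 * π) (-π)
    (fun x => ENNReal.ofReal |circleSin x| * F (circleCos x))
  simp only [circleCos_coe, circleSin_coe] at h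
  rw [AddCircle.volume_eq_smul_haarAddCircle, lintegral_smul_measure,
    show -π + 2 * π = π by ring,
    ← Ioc_union_Ioc_eq_Ioc (neg_nonpos.2 Real.pi_pos.le) Real.pi_pos.le,
    lintegral_union measurableSet_Ioc (Ioc_disjoint_Ioc_of_le le_rfl),
    lintegral_Ioc_cos_mul_abs_sin, lintegral_Ioc_neg_cos_mul_abs_sin, ← two_mul, smul_eq_mul] at h
  have h1 : ENNReal.ofReal (1 / (2 * π)) * ENNReal.ofReal (2 * π) = 1 := by
    rw [← ENNReal.ofReal_mul (by positivity), one_div_mul_cancel (by positivity)]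
    simp
  have h3 : ENNReal.ofReal (1 / (2 * π)) * 2 = ENNReal.ofReal (1 / π) := by
    rw [show (2 : ENNReal) = ENNReal.ofReal 2 by simp, ← ENNReal.ofReal_mul (by positivity)]
    congr 1
    field_simp
  rw [← h3, mul_assoc, h, ← mul_assoc, h1, one_mul]

/-- The arcsine substitution: the image of `|sin|` times Haar measure under the cosine. -/
theorem map_circleCos_withDensity :
    ((AddCircle.haarAddCircle (T := 2 * π)).withDensity
        fun x => ((‖circleSin x‖₊ : NNReal) : ENNReal)).map circleCos
      = ENNReal.ofReal (1 / π) • volume.restrict (Ioo (-1 : ℝ) 1) := by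
  refine Measure.ext_of_lintegral _ fun F hF => ?_
  rw [lintegral_map hF continuous_circleCos.measurable,
    lintegral_withDensity_eq_lintegral_mul (g := fun x => F (circleCos x)) _
      (by have := continuous_circleSin.measurable; fun_prop)
      (hF.comp continuous_circleCos.measurable), lintegral_smul_measure, smul_eq_mul,
    ← lintegral_haarAddCircle_circleCos]
  congr 1
  ext x
  simp only [Pi.mul_apply]
  rw [← Real.norm_eq_abs, ofReal_norm, enorm_eq_nnnorm]

theorem summable_mul_pow_natAbs {a : ℤ → ℂ} {M : ℝ} (ha : ∀ n, ‖a n‖ ≤ M) {r : ℝ}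
    (hr0 : 0 ≤ r) (hr1 : r < 1) : Summable fun n : ℤ => ‖a n * (r : ℂ) ^ n.natAbs‖ := by
  have hgeo : Summable fun n : ℤ => r ^ n.natAbs :=
    Summable.of_nat_of_neg (by simpa using summable_geometric_of_lt_one hr0 hr1)
      (by simpa using summable_geometric_of_lt_one hr0 hr1)
  refine Summable.of_nonneg_of_le (fun _ => norm_nonneg _) (fun n => ?_) (hgeo.mul_left M)
  rw [norm_mul, norm_pow, Complex.norm_real, Real.norm_of_nonneg hr0]
  gcongr
  exact ha n

section SquareSummable

variable {T : ℝ} [hT : Fact (0 < T)]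

open AddCircle

theorem toLp_tsum_smul_fourier {b : ℤ → ℂ} (hb : Summable fun n => ‖b n‖)
    (b' : lp (fun _ : ℤ => ℂ) 2) (hbb' : ∀ n, b' n = b n) :
    ContinuousMap.toLp 2 (haarAddCircle (T := T)) ℂ (∑' n, b n • fourier n)
      = fourierBasis.repr.symm b' := by
  have hs : Summable fun n => b n • (fourier n : C(AddCircle T, ℂ)) := by
    refine Summable.of_norm ?_
    simpa [norm_smul, fourier_norm] using hb
  have h1 := (ContinuousMap.toLp 2 (haarAddCircle (T := T)) ℂ).hasSum hs.hasSum
  refine h1.unique ?_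
  have h2 := (fourierBasis (T := T)).hasSum_repr_symm b'
  convert h2 using 2 with n
  rw [hbb', coe_fourierBasis, map_smul]

theorem inner_star_fourierLp (A : Lp ℂ 2 (haarAddCircle (T := T))) (n : ℤ) :
    inner ℂ (star A) (fourierLp 2 n) = inner ℂ (fourierLp 2 (-n)) A := by
  rw [L2.inner_def, L2.inner_def]
  refine integral_congr_ae ?_
  filter_upwards [Lp.coeFn_star A, coeFn_fourierLp (T := T) 2 n,
    coeFn_fourierLp (T := T) 2 (-n)] with x h1 h2 h3
  rw [h1, h2, h3]
  simp [mul_comm]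

theorem integral_sq_eq_zero_of_repr_eq_zero (A : Lp ℂ 2 (haarAddCircle (T := T)))
    (hA : ∀ n ≤ 0, fourierBasis.repr A n = 0) : ∫ x, A x ^ 2 ∂haarAddCircle = 0 := by
  have h := (fourierBasis (T := T)).hasSum_inner_mul_inner (star A) A
  have h0 : ∀ n : ℤ, inner ℂ (star A) (fourierBasis n) * inner ℂ (fourierBasis n) A = 0 := by
    intro n
    rw [coe_fourierBasis, inner_star_fourierLp, ← coe_fourierBasis,
      ← HilbertBasis.repr_apply_apply, ← HilbertBasis.repr_apply_apply]
    rcases le_total n 0 with hn | hn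
    · rw [hA n hn, mul_zero]
    · rw [hA (-n) (by lia), zero_mul]
  simp only [h0] at h
  have h1 := h.unique hasSum_zero
  rw [L2.inner_def] at h1
  rw [← h1]
  refine integral_congr_ae ?_
  filter_upwards [Lp.coeFn_star A] with x hx
  rw [hx]
  simp [sq]

theorem tendsto_lp_mul_pow_natAbs (a : lp (fun _ : ℤ => ℂ) 2) {r : ℕ → ℝ}
    (hr0 : ∀ k, 0 ≤ r k) (hr1 : ∀ k, r k ≤ 1) (hr : Tendsto r atTop (nhds 1))
    (b : ℕ → lp (fun _ : ℤ => ℂ) 2) (hb : ∀ k n, b k n = a n * (r k : ℂ) ^ n.natAbs) :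
    Tendsto b atTop (nhds a) := by
  rw [tendsto_iff_norm_sub_tendsto_zero]
  have hnorm : ∀ c : lp (fun _ : ℤ => ℂ) 2, ‖c‖ ^ 2 = ∑' n, ‖c n‖ ^ 2 := fun c => by
    have := lp.norm_rpow_eq_tsum (p := 2) (by simp) c
    simpa using this
  have hsum : Summable fun n => ‖a n‖ ^ 2 := by
    simpa using (lp.memℓp a).summable (by simp)
  have hle : ∀ k (n : ℤ), ‖(r k : ℂ) ^ n.natAbs - 1‖ ≤ 1 := fun k n => by
    have h1 : r k ^ n.natAbs ≤ 1 := pow_le_one₀ (hr0 k) (hr1 k)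
    have h2 : 0 ≤ r k ^ n.natAbs := pow_nonneg (hr0 k) _
    rw [show (r k : ℂ) ^ n.natAbs - 1 = ((r k ^ n.natAbs - 1 : ℝ) : ℂ) by push_cast; rfl,
      Complex.norm_real, Real.norm_eq_abs, abs_le]
    constructor <;> linarith
  have heq : ∀ k (n : ℤ), (b k - a) n = a n * ((r k : ℂ) ^ n.natAbs - 1) := fun k n => by
    rw [lp.coeFn_sub, Pi.sub_apply, hb]
    ring
  have hsq : Tendsto (fun k => ‖b k - a‖ ^ 2) atTop (nhds (∑' _ : ℤ, (0 : ℝ))) := by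
    simp_rw [hnorm, heq]
    refine tendsto_tsum_of_dominated_convergence hsum (fun n => ?_)
      (Eventually.of_forall fun k n => ?_)
    · have h1 : Tendsto (fun k => (r k : ℂ)) atTop (nhds ((1 : ℝ) : ℂ)) :=
        (Complex.continuous_ofReal.tendsto _).comp hr
      have h2 := ((((h1.pow n.natAbs).sub_const 1).const_mul (a n)).norm).pow 2
      simpa using h2
    · rw [norm_mul, mul_pow, Real.norm_of_nonneg (by positivity)]
      refine mul_le_of_le_one_right (by positivity) (pow_le_one₀ (norm_nonneg _) (hle k n))
  rw [tsum_zero] at hsq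
  have h3 := hsq.sqrt
  simpa [Real.sqrt_sq (norm_nonneg _)] using h3

/-- A square-summable Fourier series with only positive frequencies is the radial boundary value,
along a subsequence, of the corresponding power series. -/
theorem exists_memLp_radial_limit {a : ℤ → ℂ} (ha : Summable fun n => ‖a n‖ ^ 2)
    (hpos : ∀ n ≤ 0, a n = 0) {r : ℕ → ℝ} (hr0 : ∀ k, 0 ≤ r k) (hr1 : ∀ k, r k < 1)
    (hr : Tendsto r atTop (nhds 1)) :
    ∃ A : AddCircle T → ℂ, MemLp A 2 haarAddCircle ∧
      ∫ x, ‖A x‖ ^ 2 ∂haarAddCircle = ∑' n, ‖a n‖ ^ 2 ∧ ∫ x, A x ^ 2 ∂haarAddCircle = 0 ∧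
      ∃ φ : ℕ → ℕ, StrictMono φ ∧ ∀ᵐ x ∂haarAddCircle,
        Tendsto (fun k => ∑' n : ℤ, a n * (r (φ k) : ℂ) ^ n.natAbs * fourier n x) atTop
          (nhds (A x)) := by
  have hmem : Memℓp a 2 := by
    refine memℓp_gen ?_
    simpa using ha
  set a' : lp (fun _ : ℤ => ℂ) 2 := ⟨a, hmem⟩ with ha'
  have hbound : ∀ n, ‖a n‖ ≤ ‖a'‖ := fun n => lp.norm_apply_le_norm (by simp) a' n
  have hbmem : ∀ k, Memℓp (fun n : ℤ => a n * (r k : ℂ) ^ n.natAbs) 2 := fun k => by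
    refine memℓp_gen ?_
    refine Summable.of_nonneg_of_le (fun _ => by positivity) (fun n => ?_) ha
    simp only [ENNReal.toReal_ofNat, Real.rpow_ofNat, norm_mul, norm_pow, Complex.norm_real,
      Real.norm_of_nonneg (hr0 k)]
    refine pow_le_pow_left₀ (mul_nonneg (norm_nonneg _) (pow_nonneg (hr0 k) _)) ?_ 2
    exact mul_le_of_le_one_right (norm_nonneg (a n)) (pow_le_one₀ (hr0 k) (hr1 k).le)
  set b : ℕ → lp (fun _ : ℤ => ℂ) 2 := fun k => ⟨_, hbmem k⟩ with hb
  have hlim : Tendsto b atTop (nhds a') :=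
    tendsto_lp_mul_pow_natAbs a' hr0 (fun k => (hr1 k).le) hr b fun _ _ => rfl
  set A : Lp ℂ 2 (haarAddCircle (T := T)) := fourierBasis.repr.symm a' with hA
  have hrepr : ∀ n, fourierBasis.repr A n = a n := fun n => by
    rw [hA, LinearIsometryEquiv.apply_symm_apply]
  have hsummable : ∀ k, Summable fun n : ℤ => ‖a n * (r k : ℂ) ^ n.natAbs‖ := fun k =>
    summable_mul_pow_natAbs hbound (hr0 k) (hr1 k)
  have hLp : Tendsto (fun k => fourierBasis.repr.symm (b k)) atTop (nhds A) :=
    ((fourierBasis (T := T)).repr.symm.continuous.tendsto a').comp hlim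
  refine ⟨A, Lp.memLp A, ?_, ?_, ?_⟩
  · rw [← tsum_sq_fourierCoeff]
    simp_rw [← fourierBasis_repr, hrepr]
  · exact integral_sq_eq_zero_of_repr_eq_zero A fun n hn => by rw [hrepr, hpos n hn]
  · obtain ⟨φ, hφ, hae⟩ := (tendstoInMeasure_of_tendsto_Lp hLp).exists_seq_tendsto_ae
    refine ⟨φ, hφ, ?_⟩
    have hcoe : ∀ k, ∀ᵐ x ∂haarAddCircle, (fourierBasis (T := T)).repr.symm (b k) x
        = ∑' n : ℤ, a n * (r k : ℂ) ^ n.natAbs * fourier n x := fun k => by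
      rw [← toLp_tsum_smul_fourier (hsummable k) (b k) fun _ => rfl]
      filter_upwards [ContinuousMap.coeFn_toLp (haarAddCircle (T := T)) (p := 2) (𝕜 := ℂ)
        (∑' n : ℤ, (a n * (r k : ℂ) ^ n.natAbs) • fourier n)] with x hx
      rw [hx, ← ContinuousMap.tsum_apply]
      · rfl
      · refine Summable.of_norm ?_
        simpa [norm_smul, fourier_norm] using hsummable k
    filter_upwards [hae, ae_all_iff.2 hcoe] with x hx1 hx2
    simpa only [hx2] using hx1

end SquareSummable

theorem fourier_eq_pow {T : ℝ} (x : AddCircle T) (n : ℕ) :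
    fourier (n : ℤ) x = (fourier 1 x) ^ n := by
  induction n with
  | zero => simp
  | succ n ih => rw [Nat.cast_succ, fourier_add, ih, pow_succ]

theorem norm_fourier_apply {T : ℝ} (n : ℤ) (x : AddCircle T) : ‖fourier n x‖ = 1 := by
  rw [fourier_apply]
  exact Circle.norm_coe _

theorem fourierCoeff_neg_of_even {T : ℝ} [Fact (0 < T)] {g : AddCircle T → ℂ}
    (heven : ∀ x, g (-x) = g x) (n : ℤ) : fourierCoeff g (-n) = fourierCoeff g n := by
  rw [fourierCoeff, fourierCoeff, ← integral_neg_eq_self]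
  congr 1
  ext x
  rw [heven, neg_neg, fourier_apply, fourier_apply, neg_smul, smul_neg]

theorem hasSum_integral_mul_inv_one_sub_mul_fourier {T : ℝ} [Fact (0 < T)]
    {g : AddCircle T → ℂ} (hg : Integrable g AddCircle.haarAddCircle) {w : ℂ} (hw : ‖w‖ < 1)
    {ε : ℤ} (hε : ε = 1 ∨ ε = -1) :
    HasSum (fun n : ℕ => w ^ n * fourierCoeff g (-(ε * n)))
      (∫ y, g y * (1 - w * fourier ε y)⁻¹ ∂AddCircle.haarAddCircle) := by
  have hpow : ∀ (n : ℕ) (y : AddCircle T), fourier (ε * n) y = (fourier ε y) ^ n := by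
    intro n y
    rcases hε with rfl | rfl
    · rw [one_mul, fourier_eq_pow]
    · rw [neg_one_mul, fourier_neg, fourier_neg, fourier_eq_pow, map_pow]
  have hint : ∀ n : ℕ, Integrable (fun y => w ^ n * (fourier (ε * n) y * g y))
      AddCircle.haarAddCircle := fun n => by
    have := hg.fourier_smul (ε * n)
    simp only [smul_eq_mul] at this
    exact this.const_mul _
  have hnorm : ∀ (n : ℕ) (y : AddCircle T),
      ‖w ^ n * (fourier (ε * n) y * g y)‖ = ‖w‖ ^ n * ‖g y‖ := fun n y => by
    rw [norm_mul, norm_mul, norm_fourier_apply, one_mul, norm_pow]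
  have h := hasSum_integral_of_summable_integral_norm hint (by
    simp_rw [hnorm, integral_const_mul]
    exact (summable_geometric_of_lt_one (norm_nonneg _) hw).mul_right _)
  have h1 : ∀ n : ℕ, ∫ y, w ^ n * (fourier (ε * n) y * g y) ∂AddCircle.haarAddCircle
      = w ^ n * fourierCoeff g (-(ε * n)) := fun n => by
    rw [integral_const_mul, fourierCoeff, neg_neg]
    rfl
  have h2 : ∀ y : AddCircle T, ∑' n : ℕ, w ^ n * (fourier (ε * n) y * g y)
      = g y * (1 - w * fourier ε y)⁻¹ := fun y => by
    have hlt : ‖w * fourier ε y‖ < 1 := by rwa [norm_mul, norm_fourier_apply, mul_one]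
    rw [← tsum_geometric_of_norm_lt_one hlt, ← tsum_mul_left]
    congr 1
    ext n
    rw [hpow, mul_pow]
    ring
  simpa only [h1, h2] using h

theorem joukowski_sub_re_inv {w η : ℂ} (hw0 : w ≠ 0) (hw : ‖w‖ < 1) (hη : ‖η‖ = 1) :
    (1 - w ^ 2) / (2 * w) * ((w + w⁻¹) / 2 - η.re)⁻¹
      = (1 - w * η)⁻¹ + (1 - w * starRingEnd ℂ η)⁻¹ - 1 := by
  have hne : ∀ ζ : ℂ, ‖ζ‖ = 1 → 1 - w * ζ ≠ 0 := fun ζ hζ h => by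
    have : ‖w * ζ‖ = 1 := by rw [← sub_eq_zero.1 h, norm_one]
    rw [norm_mul, hζ, mul_one] at this
    exact hw.ne this
  have h1 := hne η hη
  have h2 := hne (starRingEnd ℂ η) (by rwa [RCLike.norm_conj])
  have h3 : η * starRingEnd ℂ η = 1 := by rw [Complex.mul_conj', hη]; simp
  have h4 : (w + w⁻¹) / 2 - (η.re : ℂ)
      = (1 - w * η) * (1 - w * starRingEnd ℂ η) / (2 * w) := by
    have h5 : (η.re : ℂ) = (η + starRingEnd ℂ η) / 2 := Complex.re_eq_add_conj η
    rw [h5]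
    field_simp
    linear_combination (-w ^ 2) * h3
  rw [h4]
  field_simp
  linear_combination w ^ 2 * h3

/-- In the Joukowski coordinate, the Cauchy integral of an even mean-zero function is a power
series with the Fourier coefficients as coefficients. -/
theorem joukowski_mul_integral_eq_tsum {g : AddCircle (2 * π) → ℂ}
    (hg : Integrable g AddCircle.haarAddCircle) (heven : ∀ x, g (-x) = g x)
    (h0 : fourierCoeff g 0 = 0) {r : ℝ} (hr0 : 0 < r) (hr1 : r < 1) (x : AddCircle (2 * π))
    {w : ℂ} (hw : w = r * fourier 1 x) :
    (1 - w ^ 2) / (2 * w) *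
        ∫ y, g y * ((w + w⁻¹) / 2 - circleCos y)⁻¹ ∂AddCircle.haarAddCircle
      = ∑' n : ℤ, (if 0 < n then 2 * fourierCoeff g n else 0) * (r : ℂ) ^ n.natAbs
          * fourier n x := by
  have hnorm : ‖w‖ = r := by
    rw [hw, norm_mul, norm_fourier_apply, mul_one, Complex.norm_real, Real.norm_of_nonneg hr0.le]
  have hw0 : w ≠ 0 := norm_pos_iff.1 (hnorm ▸ hr0)
  have hw1 : ‖w‖ < 1 := hnorm ▸ hr1
  have hS := (hasSum_integral_mul_inv_one_sub_mul_fourier hg hw1 (Or.inl rfl)).add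
    (hasSum_integral_mul_inv_one_sub_mul_fourier hg hw1 (Or.inr rfl))
  have hcoeff : ∀ n : ℕ, w ^ n * fourierCoeff g (-(1 * n)) + w ^ n * fourierCoeff g (-(-1 * n))
      = 2 * fourierCoeff g n * w ^ n := fun n => by
    rw [one_mul, neg_one_mul, neg_neg, fourierCoeff_neg_of_even heven]
    ring
  simp_rw [hcoeff] at hS
  have hker : ∀ ε : ℤ, Integrable (fun y => g y * (1 - w * fourier ε y)⁻¹)
      AddCircle.haarAddCircle := fun ε => by
    refine hg.mul_bdd (c := (1 - r)⁻¹) (Measurable.aestronglyMeasurable ?_) (ae_of_all _ fun y => ?_)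
    · have := (map_continuous (fourier ε : C(AddCircle (2 * π), ℂ))).measurable
      fun_prop
    · rw [norm_inv]
      have h1 : 1 - r ≤ ‖1 - w * fourier ε y‖ := by
        have := norm_sub_norm_le (1 : ℂ) (w * fourier ε y)
        rwa [norm_one, norm_mul, norm_fourier_apply, mul_one, hnorm] at this
      have h2 : 0 < 1 - r := sub_pos.2 hr1
      gcongr
  have hlhs : (1 - w ^ 2) / (2 * w) *
        ∫ y, g y * ((w + w⁻¹) / 2 - circleCos y)⁻¹ ∂AddCircle.haarAddCircle
      = (∫ y, g y * (1 - w * fourier 1 y)⁻¹ ∂AddCircle.haarAddCircle)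
        + ∫ y, g y * (1 - w * fourier (-1) y)⁻¹ ∂AddCircle.haarAddCircle := by
    have hmean : ∫ y, g y ∂AddCircle.haarAddCircle = 0 := by
      rw [← h0, fourierCoeff]
      simp
    have hsub := integral_sub ((hker 1).add (hker (-1))) hg
    rw [hmean, sub_zero] at hsub
    rw [← integral_add (hker 1) (hker (-1)), ← integral_const_mul]
    refine Eq.trans ?_ hsub
    congr 1
    ext y
    simp only [Pi.add_apply]
    rw [mul_left_comm, circleCos, joukowski_sub_re_inv hw0 hw1 (norm_fourier_apply 1 y),
      fourier_neg]
    ring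
  rw [hlhs, ← hS.tsum_eq, ← (Nat.cast_injective (R := ℤ)).tsum_eq (f := fun n : ℤ =>
    (if 0 < n then 2 * fourierCoeff g n else 0) * (r : ℂ) ^ n.natAbs * fourier n x)]
  · congr 1
    ext n
    rcases Nat.eq_zero_or_pos n with rfl | hn
    · simp [h0]
    · rw [if_pos (by exact_mod_cast hn), fourier_eq_pow, Int.natAbs_natCast, hw, mul_pow]
      ring
  · intro n hn
    by_contra hrange
    refine hn ?_
    have : ¬ 0 < n := fun hpos => hrange ⟨n.toNat, by simp [hpos.le]⟩
    simp [this]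

theorem aestronglyMeasurable_comp_circleCos {E : Type*} [TopologicalSpace E] {Φ : ℝ → E}
    (hΦ : AEStronglyMeasurable Φ (volume.restrict (Ioo (-1 : ℝ) 1))) :
    AEStronglyMeasurable Φ (((AddCircle.haarAddCircle (T := 2 * π)).withDensity
        fun x => ((‖circleSin x‖₊ : NNReal) : ENNReal)).map circleCos) := by
  rw [map_circleCos_withDensity]
  exact hΦ.smul_measure _

section Substitution

variable {E : Type*} [NormedAddCommGroup E] [NormedSpace ℝ E]

theorem aestronglyMeasurable_abs_circleSin_smul {Φ : ℝ → E}
    (hΦ : AEStronglyMeasurable Φ (volume.restrict (Ioo (-1 : ℝ) 1))) :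
    AEStronglyMeasurable (fun x => |circleSin x| • Φ (circleCos x))
      (AddCircle.haarAddCircle (T := 2 * π)) :=
  (aestronglyMeasurable_withDensity_iff continuous_circleSin.measurable.nnnorm).1
    ((aestronglyMeasurable_comp_circleCos hΦ).comp_measurable continuous_circleCos.measurable)

theorem integrable_abs_circleSin_smul_iff {Φ : ℝ → E}
    (hΦ : AEStronglyMeasurable Φ (volume.restrict (Ioo (-1 : ℝ) 1))) :
    Integrable (fun x => |circleSin x| • Φ (circleCos x))
      (AddCircle.haarAddCircle (T := 2 * π)) ↔ IntegrableOn Φ (Ioo (-1 : ℝ) 1) := by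
  have h1 := integrable_map_measure (aestronglyMeasurable_comp_circleCos hΦ)
    continuous_circleCos.measurable.aemeasurable
  rw [integrable_withDensity_iff_integrable_coe_smul continuous_circleSin.measurable.nnnorm,
    map_circleCos_withDensity, integrable_smul_measure
      (ENNReal.ofReal_pos.2 (by positivity)).ne' ENNReal.ofReal_ne_top] at h1
  exact h1.symm

theorem integral_abs_circleSin_smul {Φ : ℝ → E}
    (hΦ : AEStronglyMeasurable Φ (volume.restrict (Ioo (-1 : ℝ) 1))) :
    ∫ x, |circleSin x| • Φ (circleCos x) ∂(AddCircle.haarAddCircle (T := 2 * π))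
      = (1 / π) • ∫ x in Ioo (-1 : ℝ) 1, Φ x := by
  have h1 := integral_map continuous_circleCos.measurable.aemeasurable
    (aestronglyMeasurable_comp_circleCos hΦ)
  rw [integral_withDensity_eq_integral_smul continuous_circleSin.measurable.nnnorm,
    map_circleCos_withDensity, integral_smul_measure,
    ENNReal.toReal_ofReal (by positivity)] at h1
  exact h1.symm

end Substitution

theorem ae_circleSin_ne_zero :
    ∀ᵐ x ∂(AddCircle.haarAddCircle (T := 2 * π)), circleSin x ≠ 0 := by
  have h1 : ∀ᵐ θ : ℝ, Real.sin θ ≠ 0 := by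
    have hc : {θ : ℝ | Real.sin θ = 0}.Countable := by
      refine (countable_range fun n : ℤ => (n : ℝ) * π).mono fun θ hθ => ?_
      exact Real.sin_eq_zero_iff.1 hθ
    simpa [ae_iff] using hc.measure_zero volume
  have hmp := AddCircle.measurePreserving_mk (2 * π) (-π)
  have h2 : ∀ᵐ x : AddCircle (2 * π), circleSin x ≠ 0 := by
    rw [← hmp.map_eq]
    refine (ae_map_iff hmp.measurable.aemeasurable (p := fun x => circleSin x ≠ 0)
      (measurableSet_eq_fun continuous_circleSin.measurable measurable_const).compl).2 ?_
    simp only [circleSin_coe]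
    exact ae_restrict_of_ae h1
  rwa [AddCircle.volume_eq_smul_haarAddCircle, Measure.ae_ennreal_smul_measure_iff
    (ENNReal.ofReal_pos.2 (by positivity)).ne'] at h2

theorem ae_comp_circleCos {P : ℝ → Prop}
    (h : ∀ᵐ x ∂(volume.restrict (Ioo (-1 : ℝ) 1)), P x) :
    ∀ᵐ x ∂(AddCircle.haarAddCircle (T := 2 * π)), P (circleCos x) := by
  have h1 : ∀ᵐ x ∂((AddCircle.haarAddCircle (T := 2 * π)).withDensity
        fun x => ((‖circleSin x‖₊ : NNReal) : ENNReal)), P (circleCos x) := by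
    refine ae_of_ae_map continuous_circleCos.measurable.aemeasurable ?_
    rw [map_circleCos_withDensity]
    exact Measure.ae_smul_measure h _
  rw [ae_withDensity_iff (by have := continuous_circleSin.measurable; fun_prop)] at h1
  filter_upwards [h1, ae_circleSin_ne_zero] with x hx hx0
  exact hx (by simpa using hx0)

theorem sqrt_one_sub_circleCos_sq (x : AddCircle (2 * π)) :
    Real.sqrt (1 - circleCos x ^ 2) = |circleSin x| := by
  rw [← circleCos_sq_add_circleSin_sq x, add_sub_cancel_left, Real.sqrt_sq_eq_abs]

theorem abs_circleSin_smul_sq_mul_sqrt (F : ℝ → ℝ) (x : AddCircle (2 * π)) :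
    |circleSin x| • (F (circleCos x) ^ 2 * Real.sqrt (1 - circleCos x ^ 2))
      = (|circleSin x| * F (circleCos x)) ^ 2 := by
  rw [sqrt_one_sub_circleCos_sq, smul_eq_mul]
  ring

theorem aestronglyMeasurable_of_hasFiniteHilbertAt {f Hf : ℝ → ℝ}
    (hf : IntegrableOn f (Ioo (-1 : ℝ) 1))
    (hH : ∀ᵐ x ∂(volume.restrict (Ioo (-1 : ℝ) 1)), HasFiniteHilbertAt f x (Hf x)) :
    AEStronglyMeasurable Hf (volume.restrict (Ioo (-1 : ℝ) 1)) := by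
  have hy : Tendsto (fun k : ℕ => 1 / ((k : ℝ) + 1)) atTop (nhdsWithin 0 (Ioi 0)) :=
    tendsto_nhdsWithin_iff.2 ⟨tendsto_one_div_add_atTop_nhds_zero_nat,
      Eventually.of_forall fun k => mem_Ioi.2 (by positivity)⟩
  refine aestronglyMeasurable_of_tendsto_ae atTop (f := fun (k : ℕ) x => (1 / π) *
    ∫ t in Ioo (-1 : ℝ) 1, f t * ((x - t) / ((x - t) ^ 2 + (1 / ((k : ℝ) + 1)) ^ 2)))
    (fun k => ?_) ?_
  · refine AEStronglyMeasurable.const_mul ?_ _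
    refine AEStronglyMeasurable.integral_prod_right'
      (f := fun p : ℝ × ℝ => f p.2 * ((p.1 - p.2) / ((p.1 - p.2) ^ 2 + (1 / ((k : ℝ) + 1)) ^ 2)))
      ?_
    exact hf.aestronglyMeasurable.comp_snd.mul
      (Measurable.aestronglyMeasurable (by fun_prop))
  · filter_upwards [hH] with x hx
    exact (hx.tendsto_conjugatePoisson hf).comp hy

theorem joukowski_polar (r : ℝ) (x : AddCircle (2 * π)) :
    ((r : ℂ) * fourier 1 x + ((r : ℂ) * fourier 1 x)⁻¹) / 2
      = ⟨(r + r⁻¹) / 2 * circleCos x, (r - r⁻¹) / 2 * circleSin x⟩ := by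
  have h1 : (fourier 1 x : ℂ)⁻¹ = starRingEnd ℂ (fourier 1 x) := by
    rw [Complex.inv_def, Complex.normSq_eq_norm_sq, norm_fourier_apply]
    simp
  rw [mul_inv, h1, ← Complex.ofReal_inv, circleCos, circleSin]
  apply Complex.ext
  · simp
    ring
  · simp
    ring

theorem abs_joukowski_re_sub_le {r c s : ℝ} (hr0 : 0 < r) (hs : s ≠ 0)
    (hcs : c ^ 2 + s ^ 2 = 1) :
    |(r + r⁻¹) / 2 * c - c| ≤ (1 / s ^ 2) * ((r - r⁻¹) / 2 * s) ^ 2 := by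
  have hc : |c| ≤ 1 := abs_le_one_iff_mul_self_le_one.2 (by nlinarith [sq_nonneg s])
  have h1 : (r + r⁻¹) / 2 * c - c = (1 - r) ^ 2 / (2 * r) * c := by
    field_simp
    ring
  have h2 : (1 / s ^ 2) * ((r - r⁻¹) / 2 * s) ^ 2
      = (1 - r) ^ 2 / (2 * r) * ((1 + r) ^ 2 / (2 * r)) := by
    field_simp
    ring
  rw [h1, h2, abs_mul, abs_of_nonneg (by positivity)]
  gcongr
  refine hc.trans ?_
  rw [le_div_iff₀ (by positivity)]
  nlinarith [sq_nonneg r]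

theorem integral_im_sq {α : Type*} [MeasurableSpace α] {μ : Measure α} {A : α → ℂ}
    (hA : MemLp A 2 μ) (h0 : ∫ x, A x ^ 2 ∂μ = 0) :
    ∫ x, (A x).im ^ 2 ∂μ = (∫ x, ‖A x‖ ^ 2 ∂μ) / 2 := by
  have hre : MemLp (fun x => (A x).re) 2 μ := hA.re
  have him : MemLp (fun x => (A x).im) 2 μ := hA.im
  have hmul : Integrable (fun x => (A x) * (A x)) μ := hA.integrable_mul hA
  have h1 := Complex.reCLM.integral_comp_comm hmul
  simp only [← sq, h0, Complex.reCLM_apply, Complex.zero_re] at h1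
  have h2 : ∀ x, (A x ^ 2).re = (A x).re ^ 2 - (A x).im ^ 2 := fun x => by
    rw [sq, Complex.mul_re]; ring
  have h3 : ∀ x, ‖A x‖ ^ 2 = (A x).re ^ 2 + (A x).im ^ 2 := fun x => by
    rw [Complex.sq_norm, Complex.normSq_apply]; ring
  simp_rw [h2] at h1
  simp_rw [h3]
  rw [integral_sub hre.integrable_sq him.integrable_sq] at h1
  rw [integral_add hre.integrable_sq him.integrable_sq]
  linarith

theorem tsum_positive_frequencies {c : ℤ → ℂ} (hc : Summable fun n => ‖c n‖ ^ 2)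
    (heven : ∀ n, c (-n) = c n) (h0 : c 0 = 0) :
    (Summable fun n : ℤ => ‖if 0 < n then 2 * c n else 0‖ ^ 2) ∧
      ∑' n : ℤ, ‖if 0 < n then 2 * c n else 0‖ ^ 2 = 2 * ∑' n, ‖c n‖ ^ 2 := by
  obtain ⟨p, hp⟩ : ∃ p : ℤ → ℝ, ∀ n, p n = if 0 < n then ‖c n‖ ^ 2 else 0 := ⟨_, fun _ => rfl⟩
  have hps : Summable p := by
    refine Summable.of_nonneg_of_le (fun n => ?_) (fun n => ?_) hc <;> rw [hp] <;> split_ifs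
    · positivity
    · exact le_rfl
    · exact le_rfl
    · positivity
  have h4 : ∀ n : ℤ, ‖if 0 < n then 2 * c n else 0‖ ^ 2 = 4 * p n := by
    intro n
    rw [hp]
    split_ifs
    · rw [norm_mul, mul_pow, Complex.norm_ofNat]
      norm_num
    · simp
  have hsplit : ∀ n, ‖c n‖ ^ 2 = p n + p (-n) := by
    intro n
    rw [hp, hp, heven]
    rcases lt_trichotomy n 0 with hn | rfl | hn
    · simp [hn, hn.le]
    · simp [h0]
    · simp [hn, hn.le]
  have hneg : HasSum (fun n => p (-n)) (∑' n, p n) := (Equiv.neg ℤ).hasSum_iff.2 hps.hasSum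
  simp_rw [h4, hsplit]
  rw [(hps.hasSum.add hneg).tsum_eq, tsum_mul_left]
  exact ⟨hps.mul_left 4, by ring⟩

theorem eq_neg_im_div_of_tendsto {f : ℝ → ℝ} {L : ℝ} {x : AddCircle (2 * π)} {A : ℂ}
    (hf : IntegrableOn f (Ioo (-1 : ℝ) 1)) (hs : circleSin x ≠ 0)
    (hH : HasFiniteHilbertAt f (circleCos x) L) {r : ℕ → ℝ} (hr0 : ∀ k, 0 < r k)
    (hr1 : ∀ k, r k < 1) (hr : Tendsto r atTop (nhds 1))
    (hA : Tendsto (fun k => (1 - ((r k : ℂ) * fourier 1 x) ^ 2) / (2 * ((r k : ℂ) * fourier 1 x)) *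
      ((1 / π : ℝ) * ∫ t in Ioo (-1 : ℝ) 1, (f t : ℂ) *
        ((((r k : ℂ) * fourier 1 x) + ((r k : ℂ) * fourier 1 x)⁻¹) / 2 - t)⁻¹)) atTop (nhds A)) :
    L = -A.im / circleSin x := by
  set e : ℂ := fourier 1 x with he
  have he1 : ‖e‖ = 1 := norm_fourier_apply 1 x
  have he0 : e ≠ 0 := norm_pos_iff.1 (by rw [he1]; exact one_pos)
  have hrC : Tendsto (fun k => (r k : ℂ)) atTop (nhds ((1 : ℝ) : ℂ)) :=
    (Complex.continuous_ofReal.tendsto _).comp hr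
  have hw : Tendsto (fun k => (r k : ℂ) * e) atTop (nhds e) := by
    simpa using hrC.mul_const e
  have hee : e * starRingEnd ℂ e = 1 := by rw [Complex.mul_conj', he1]; simp
  have hsub : e - starRingEnd ℂ e = 2 * circleSin x * Complex.I := by
    rw [Complex.sub_conj]
    push_cast
    rfl
  have hsC : (circleSin x : ℂ) ≠ 0 := by exact_mod_cast hs
  have h1e : 1 - e ^ 2 = -e * (2 * circleSin x * Complex.I) := by
    rw [← hsub]
    linear_combination (-1 : ℂ) * hee
  have h1e0 : 1 - e ^ 2 ≠ 0 := by
    rw [h1e]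
    simp [he0, hsC]
  have hq : Tendsto (fun k => 2 * ((r k : ℂ) * e) / (1 - ((r k : ℂ) * e) ^ 2)) atTop
      (nhds (2 * e / (1 - e ^ 2))) :=
    (hw.const_mul 2).div ((hw.pow 2).const_sub 1) h1e0
  have hI := hA.mul hq
  have hz : Tendsto (fun k => ((r k : ℂ) * e + ((r k : ℂ) * e)⁻¹) / 2) atTop
      (nhds (circleCos x : ℂ)) := by
    have h1 := ((hw.add (hw.inv₀ he0)).div_const 2)
    have h2 := joukowski_polar 1 x
    simp only [Complex.ofReal_one, one_mul, ← he] at h2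
    rw [h2] at h1
    convert h1 using 2
    apply Complex.ext <;> simp
  have hre := hH.tendsto_re_cauchyIntegral (C := 1 / circleSin x ^ 2) hf hz
    (fun k => by
      rw [joukowski_polar]
      have h1 : 1 < (r k)⁻¹ := (one_lt_inv₀ (hr0 k)).2 (hr1 k)
      have h2 : (r k - (r k)⁻¹) / 2 < 0 := by linarith [hr1 k]
      exact mul_ne_zero h2.ne hs)
    (fun k => by
      rw [joukowski_polar]
      exact abs_joukowski_re_sub_le (hr0 k) hs (circleCos_sq_add_circleSin_sq x))
  have hI' := (Complex.continuous_re.tendsto _).comp hI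
  have huniq := tendsto_nhds_unique hre (hI'.congr fun k => ?_)
  · rw [huniq, h1e]
    have : A * (2 * e / (-e * (2 * circleSin x * Complex.I)))
        = A * Complex.I * ((circleSin x)⁻¹ : ℝ) := by
      push_cast
      field_simp
      rw [Complex.I_sq]
      ring
    rw [this, Complex.re_mul_ofReal]
    simp [div_eq_mul_inv]
  · have hrk : (r k : ℂ) * e ≠ 0 := mul_ne_zero (by exact_mod_cast (hr0 k).ne') he0
    have hrk1 : 1 - ((r k : ℂ) * e) ^ 2 ≠ 0 := by
      intro h
      have h1 : ‖((r k : ℂ) * e) ^ 2‖ = 1 := by rw [← sub_eq_zero.1 h, norm_one]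
      rw [norm_pow, norm_mul, he1, mul_one, Complex.norm_real,
        Real.norm_of_nonneg (hr0 k).le] at h1
      nlinarith [hr0 k, hr1 k]
    simp only [Function.comp_apply]
    rw [← Complex.re_ofReal_mul]
    congr 1
    have hcancel : ∀ u v J : ℂ, u ≠ 0 → v ≠ 0 → v / (2 * u) * J * (2 * u / v) = J := by
      intro u v J hu hv
      field_simp
    exact hcancel _ _ _ hrk hrk1

/-- **A localized Parseval-type identity.** If `f(x)(1-x²)^{1/4} ∈ L²(-1,1)` and
`∫_{-1}^1 f = 0` (i.e. `f(x)√(1-x²)` has arcsine mean zero), and `Hf` is the finite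
Hilbert transform of `f` (existing a.e. on `(-1,1)`), then
`∫_{-1}^1 (Hf)² √(1-x²) dx = ∫_{-1}^1 f² √(1-x²) dx`. -/
theorem hilbert_weighted_parseval (f Hf : ℝ → ℝ)
    (hmeas : AEStronglyMeasurable f (volume.restrict (Ioo (-1 : ℝ) 1)))
    (hL2 : IntegrableOn (fun x => f x ^ 2 * Real.sqrt (1 - x ^ 2)) (Ioo (-1 : ℝ) 1))
    (hmean : ∫ x in Ioo (-1 : ℝ) 1, f x = 0)
    (hH : ∀ᵐ x ∂(volume.restrict (Ioo (-1 : ℝ) 1)), HasFiniteHilbertAt f x (Hf x)) :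
    ∫ x in Ioo (-1 : ℝ) 1, Hf x ^ 2 * Real.sqrt (1 - x ^ 2)
      = ∫ x in Ioo (-1 : ℝ) 1, f x ^ 2 * Real.sqrt (1 - x ^ 2) := by
  set G : AddCircle (2 * π) → ℝ := fun x => |circleSin x| * f (circleCos x) with hG
  have hGmeas : AEStronglyMeasurable G AddCircle.haarAddCircle :=
    aestronglyMeasurable_abs_circleSin_smul hmeas
  have hGsq : Integrable (fun x => G x ^ 2) AddCircle.haarAddCircle := by
    have h := (integrable_abs_circleSin_smul_iff hL2.aestronglyMeasurable).2 hL2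
    simpa only [abs_circleSin_smul_sq_mul_sqrt] using h
  have hGL2 : MemLp G 2 AddCircle.haarAddCircle := (memLp_two_iff_integrable_sq hGmeas).2 hGsq
  have hf : IntegrableOn f (Ioo (-1 : ℝ) 1) :=
    (integrable_abs_circleSin_smul_iff hmeas).1 (hGL2.integrable one_le_two)
  set g : AddCircle (2 * π) → ℂ := fun x => (G x : ℂ) with hg
  have hgL2 : MemLp g 2 AddCircle.haarAddCircle := hGL2.ofReal
  have hgint : Integrable g AddCircle.haarAddCircle := hgL2.integrable one_le_two
  have hgeven : ∀ x, g (-x) = g x := fun x => by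
    have h1 : fourier 1 (-x) = starRingEnd ℂ (fourier 1 x : ℂ) := by
      rw [← fourier_neg, fourier_apply, fourier_apply, smul_neg, neg_smul]
    simp only [hg, hG, circleCos, circleSin, h1, Complex.conj_re, Complex.conj_im, abs_neg]
  have hg0 : fourierCoeff g 0 = 0 := by
    have h1 : ∫ x, G x ∂AddCircle.haarAddCircle = 0 := by
      have := integral_abs_circleSin_smul hmeas
      rwa [hmean, smul_zero] at this
    have h2 : ∫ x, g x ∂AddCircle.haarAddCircle = 0 := by
      rw [hg, integral_complex_ofReal, h1, Complex.ofReal_zero]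
    simpa [fourierCoeff] using h2
  have hParseval : HasSum (fun n => ‖fourierCoeff g n‖ ^ 2)
      (∫ x, G x ^ 2 ∂AddCircle.haarAddCircle) := by
    have h := hasSum_sq_fourierCoeff (hgL2.toLp g)
    simp_rw [fourierCoeff_congr_ae hgL2.coeFn_toLp] at h
    convert h using 1
    refine integral_congr_ae ?_
    filter_upwards [hgL2.coeFn_toLp] with x hx
    rw [hx, hg, Complex.norm_real, Real.norm_eq_abs, sq_abs]
  obtain ⟨hsum, htsum⟩ := tsum_positive_frequencies hParseval.summable
    (fourierCoeff_neg_of_even hgeven) hg0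
  set r : ℕ → ℝ := fun k => 1 - 1 / ((k : ℝ) + 2) with hr
  have hr0 : ∀ k, 0 < r k := fun k => by
    rw [hr, sub_pos, div_lt_one (by positivity)]
    linarith [(Nat.cast_nonneg k : (0 : ℝ) ≤ k)]
  have hr1 : ∀ k, r k < 1 := fun k => sub_lt_self _ (by positivity)
  have hrlim : Tendsto r atTop (nhds 1) := by
    have h := (tendsto_const_nhds (x := (1 : ℝ))).sub (tendsto_const_nhds.div_atTop
      (tendsto_atTop_add_const_right _ (2 : ℝ) tendsto_natCast_atTop_atTop) (a := (1 : ℝ)))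
    rwa [sub_zero] at h
  obtain ⟨A, hAL2, hAnorm, hAsq, φ, hφ, hAlim⟩ := exists_memLp_radial_limit (T := 2 * π) hsum
    (fun n hn => if_neg hn.not_gt) (fun k => (hr0 k).le) hr1 hrlim
  have hHA : ∀ᵐ x ∂AddCircle.haarAddCircle,
      (|circleSin x| * Hf (circleCos x)) ^ 2 = (A x).im ^ 2 := by
    filter_upwards [hAlim, ae_comp_circleCos hH, ae_circleSin_ne_zero] with x hx hHx hsx
    have hHf := eq_neg_im_div_of_tendsto (A := A x) (r := fun k => r (φ k)) hf hsx hHx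
      (fun k => hr0 _) (fun k => hr1 _) (hrlim.comp hφ.tendsto_atTop) (hx.congr fun k => by
        rw [← joukowski_mul_integral_eq_tsum hgint hgeven hg0 (hr0 (φ k)) (hr1 (φ k)) x rfl]
        congr 1
        have h := integral_abs_circleSin_smul (Φ := fun t : ℝ => (f t : ℂ) *
          (((r (φ k) : ℂ) * fourier 1 x + ((r (φ k) : ℂ) * fourier 1 x)⁻¹) / 2 - t)⁻¹)
          (hf.ofReal.aestronglyMeasurable.mul (Measurable.aestronglyMeasurable (by fun_prop)))
        rw [Complex.real_smul] at h
        rw [← h]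
        congr 1
        ext y
        simp only [hg, hG, Complex.real_smul]
        push_cast
        ring)
    rw [hHf, mul_pow, sq_abs, div_pow, mul_div_cancel₀ _ (by positivity), neg_sq]
  have hHmeas := aestronglyMeasurable_of_hasFiniteHilbertAt hf hH
  have h1 := integral_abs_circleSin_smul hL2.aestronglyMeasurable
  have h2 := integral_abs_circleSin_smul (Φ := fun x => Hf x ^ 2 * Real.sqrt (1 - x ^ 2))
    ((hHmeas.pow 2).mul (Measurable.aestronglyMeasurable (by fun_prop)))
  simp only [abs_circleSin_smul_sq_mul_sqrt] at h1 h2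
  rw [integral_congr_ae hHA, integral_im_sq hAL2 hAsq, hAnorm, htsum, hParseval.tsum_eq,
    mul_div_cancel_left₀ _ two_ne_zero, h1] at h2
  exact (smul_right_injective ℝ (by positivity : (1 / π : ℝ) ≠ 0) h2).symm
end

section
/- Let f : (-1,1) → ℝ be measurable with f(x)·(1-x²)^{1/4} ∈ L²(-1,1) and ∫_{-1}^{1} f(x) dx = 0. If the finite Hilbert transform (Hf)(x) vanishes for almost every x ∈ (-1,1), then f(x) = 0 for almost every x ∈ (-1,1). -/
open MeasureTheory Filter Set Real

open Topology
open Polynomial.Chebyshev (measureT)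

lemma integrable_of_sq_mul_sqrt {f : ℝ → ℝ}
    (hmeas : AEStronglyMeasurable f (volume.restrict (Ioo (-1 : ℝ) 1)))
    (hL2 : IntegrableOn (fun x => f x ^ 2 * √(1 - x ^ 2)) (Ioo (-1 : ℝ) 1)) :
    IntegrableOn f (Ioo (-1 : ℝ) 1) := by
  have h1 : IntegrableOn (fun x : ℝ => √(1 - x ^ 2)⁻¹) (Ioo (-1 : ℝ) 1) :=
    ((intervalIntegrable_iff_integrableOn_Ioo_of_le (by norm_num)).1
      Polynomial.Chebyshev.intervalIntegrable_sqrt_one_sub_sq_inv)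
  refine (hL2.add h1).mono' hmeas ?_
  filter_upwards [ae_restrict_mem measurableSet_Ioo] with x hx
  have hs : 0 < 1 - x ^ 2 := by nlinarith [hx.1, hx.2]
  have hs' := Real.sqrt_pos.2 hs
  rw [Pi.add_apply, Real.sqrt_inv, Real.norm_eq_abs, ← sq_abs]
  set s := √(1 - x ^ 2)
  have : |f x| * s ≤ |f x| ^ 2 * s ^ 2 + 1 := by
    nlinarith [sq_nonneg (|f x| * s - 1), sq_nonneg (|f x| * s)]
  calc |f x| = (|f x| * s) * s⁻¹ := by field_simp
    _ ≤ (|f x| ^ 2 * s ^ 2 + 1) * s⁻¹ := by gcongr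
    _ = _ := by field_simp

instance : IsFiniteMeasure measureT := by
  have := Polynomial.Chebyshev.integrable_measureT (f := fun _ => (1 : ℝ)) continuousOn_const
  simpa [integrable_const_iff] using this

lemma measureT_absolutelyContinuous : measureT ≪ volume.restrict (Ioo (-1 : ℝ) 1) := by
  rw [measureT, restrict_withDensity measurableSet_Ioc, ← restrict_Ioo_eq_restrict_Ioc]
  exact withDensity_absolutelyContinuous _ _

lemma integral_cos_mul_cos_measureT (m n : ℕ) :
    ∫ x, cos ((m + 1 : ℕ) * arccos x) * cos ((n + 1 : ℕ) * arccos x) ∂measureT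
      = if m = n then π / 2 else 0 := by
  have h (k : ℕ) : ∀ᵐ x ∂measureT,
      cos ((k : ℕ) * arccos x) = (Polynomial.Chebyshev.T ℝ k).eval x := by
    filter_upwards [measureT_absolutelyContinuous.ae_le (ae_restrict_mem measurableSet_Ioo)]
      with x hx
    conv_rhs => rw [← cos_arccos hx.1.le hx.2.le, Polynomial.Chebyshev.T_real_cos]
    simp
  rw [integral_congr_ae (g := fun x => (Polynomial.Chebyshev.T ℝ (m + 1 : ℕ)).eval x *
    (Polynomial.Chebyshev.T ℝ (n + 1 : ℕ)).eval x)
    (by filter_upwards [h (m + 1), h (n + 1)] with x h1 h2; simp only [h1, h2])]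
  split_ifs with hmn
  · subst hmn
    exact Polynomial.Chebyshev.integral_T_real_mul_self_measureT_of_ne_zero (by simp)
  · exact Polynomial.Chebyshev.integral_eval_T_real_mul_eval_T_real_measureT_of_ne (by simpa)

lemma integral_sin_mul_sin_measureT (m n : ℕ) :
    ∫ x, sin ((m + 1 : ℕ) * arccos x) * sin ((n + 1 : ℕ) * arccos x) ∂measureT
      = if m = n then π / 2 else 0 := by
  have hk (k : ℤ) (hk : k ≠ 0) : ∫ θ in 0..π, cos (k * θ) = 0 := by
    have := Polynomial.Chebyshev.integral_eval_T_real_measureT_of_ne_zero hk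
    rw [Polynomial.Chebyshev.integral_measureT_eq_integral_cos] at this
    simpa [Polynomial.Chebyshev.T_real_cos] using this
  rw [Polynomial.Chebyshev.integral_measureT_eq_integral_cos,
    intervalIntegral.integral_congr (g := fun θ => (1 / 2 : ℝ) * cos ((m - n : ℤ) * θ)
      - (1 / 2 : ℝ) * cos ((m + n + 2 : ℤ) * θ))]
  · rw [intervalIntegral.integral_sub (by apply Continuous.intervalIntegrable; fun_prop)
      (by apply Continuous.intervalIntegrable; fun_prop),
      intervalIntegral.integral_const_mul, intervalIntegral.integral_const_mul]
    have h2 := hk (m + n + 2) (by omega)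
    push_cast at h2 ⊢
    rw [h2]
    split_ifs with hmn
    · subst hmn; simp; ring
    · have h1 := hk (m - n) (by omega)
      push_cast at h1
      rw [h1]; simp
  · intro θ hθ
    rw [uIcc_of_le pi_pos.le] at hθ
    simp only [arccos_cos hθ.1 hθ.2]
    push_cast
    have e1 : ((m : ℝ) - n) * θ = (m + 1) * θ - (n + 1) * θ := by ring
    have e2 : ((m : ℝ) + n + 2) * θ = (m + 1) * θ + (n + 1) * θ := by ring
    rw [e1, e2, cos_sub, cos_add]; ring

lemma integral_tsum_mul_measureT {b : ℕ → ℝ} (hb : Summable fun n => |b n|) {G : ℝ → ℝ}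
    (hG : Continuous G) {M : ℝ} (hM : ∀ x, |G x| ≤ M) :
    ∫ x, (∑' n, b n * sin ((n + 1 : ℕ) * arccos x)) * G x ∂measureT
      = ∑' n, b n * ∫ x, sin ((n + 1 : ℕ) * arccos x) * G x ∂measureT := by
  have hle (n : ℕ) (x : ℝ) : ‖b n * sin ((n + 1 : ℕ) * arccos x) * G x‖ ≤ |b n| * M := by
    rw [norm_mul, norm_mul, Real.norm_eq_abs, Real.norm_eq_abs, Real.norm_eq_abs]
    have := abs_sin_le_one ((n + 1 : ℕ) * arccos x)
    have h1 : |b n| * |sin ((n + 1 : ℕ) * arccos x)| ≤ |b n| :=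
      mul_le_of_le_one_right (abs_nonneg _) this
    exact mul_le_mul h1 (hM x) (abs_nonneg _) (abs_nonneg _)
  have key := hasSum_integral_of_dominated_convergence (μ := measureT)
    (F := fun n x => b n * sin ((n + 1 : ℕ) * arccos x) * G x)
    (f := fun x => (∑' n, b n * sin ((n + 1 : ℕ) * arccos x)) * G x)
    (fun n _ => |b n| * M) (fun n => by
      apply Continuous.aestronglyMeasurable
      have := continuous_arccos
      fun_prop)
    (fun n => ae_of_all _ (hle n)) (ae_of_all _ fun _ => hb.mul_right M)
    (integrable_const _) (ae_of_all _ fun x => by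
      refine HasSum.mul_right _ (Summable.hasSum ?_)
      refine hb.of_norm_bounded fun n => ?_
      rw [norm_mul]
      exact mul_le_of_le_one_right (abs_nonneg _) (abs_sin_le_one _))
  rw [← key.tsum_eq]
  simp_rw [mul_assoc, integral_const_mul]

lemma continuous_sineSeries {b : ℕ → ℝ} (hb : Summable fun n => |b n|) :
    Continuous fun x => ∑' n, b n * sin ((n + 1 : ℕ) * arccos x) := by
  have := continuous_arccos
  refine continuous_tsum (u := fun n => |b n|) (fun n => by fun_prop) hb fun n x => ?_
  rw [norm_mul]
  exact mul_le_of_le_one_right (abs_nonneg _) (abs_sin_le_one _)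

lemma abs_sineSeries_le {b : ℕ → ℝ} (hb : Summable fun n => |b n|) (x : ℝ) :
    |∑' n, b n * sin ((n + 1 : ℕ) * arccos x)| ≤ ∑' n, |b n| := by
  rw [← Real.norm_eq_abs]
  refine tsum_of_norm_bounded hb.hasSum fun n => ?_
  rw [norm_mul]
  exact mul_le_of_le_one_right (abs_nonneg _) (abs_sin_le_one _)

lemma integral_sineSeries_sq {b : ℕ → ℝ} (hb : Summable fun n => |b n|) :
    ∫ x, (∑' n, b n * sin ((n + 1 : ℕ) * arccos x)) ^ 2 ∂measureT
      = π / 2 * ∑' n, b n ^ 2 := by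
  have hac := continuous_arccos
  have h1 (m : ℕ) : ∫ x, sin ((m + 1 : ℕ) * arccos x) *
      (∑' n, b n * sin ((n + 1 : ℕ) * arccos x)) ∂measureT = π / 2 * b m := by
    simp_rw [mul_comm (sin _) (tsum _)]
    rw [integral_tsum_mul_measureT hb (by fun_prop) (fun x => abs_sin_le_one _)]
    simp_rw [integral_sin_mul_sin_measureT]
    rw [tsum_eq_single m (by intro n hn; simp [hn])]
    simp; ring
  simp_rw [sq]
  rw [integral_tsum_mul_measureT hb (continuous_sineSeries hb) (abs_sineSeries_le hb)]
  simp_rw [h1]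
  rw [← tsum_mul_left]
  congr! 2 with n
  ring

/-- The kernel of the conjugate Abel–Poisson means of Chebyshev series, with `τ = (1 - ρ)² / (2ρ)`
for the Abel parameter `ρ`. -/
noncomputable def conjKernel (τ x y : ℝ) : ℝ :=
  (y - x + τ * y) / ((y - x) ^ 2 + τ * (2 + τ - 2 * x * y))

lemma hasSum_pow_mul_sin {ρ : ℝ} (h0 : 0 < ρ) (h1 : ρ < 1) (α : ℝ) :
    HasSum (fun n : ℕ => ρ ^ (n + 1) * sin ((n + 1 : ℕ) * α))
      (ρ * sin α / (1 - 2 * ρ * cos α + ρ ^ 2)) := by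
  set w : ℂ := ρ * Complex.exp (α * Complex.I) with hw
  have hn : ‖w‖ < 1 := by
    rw [hw, norm_mul, Complex.norm_exp_ofReal_mul_I, Complex.norm_real, Real.norm_eq_abs,
      abs_of_pos h0, mul_one]; exact h1
  have hs := Complex.hasSum_im ((hasSum_geometric_of_norm_lt_one hn).mul_left w)
  have hre : w.re = ρ * cos α := by
    rw [hw, Complex.re_ofReal_mul, Complex.exp_ofReal_mul_I_re]
  have him : w.im = ρ * sin α := by
    rw [hw, Complex.im_ofReal_mul, Complex.exp_ofReal_mul_I_im]
  convert hs using 1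
  · ext n
    rw [← pow_succ', hw, mul_pow, ← Complex.exp_nat_mul, ← Complex.ofReal_pow,
      Complex.im_ofReal_mul]
    rw [← mul_assoc, ← Complex.ofReal_natCast, ← Complex.ofReal_mul, Complex.exp_ofReal_mul_I_im]
  · have hne : Complex.normSq (1 - w) = 1 - 2 * ρ * cos α + ρ ^ 2 := by
      rw [Complex.normSq_apply]
      simp only [Complex.sub_re, Complex.sub_im, Complex.one_re, Complex.one_im, hre, him]
      linear_combination (ρ ^ 2) * sin_sq_add_cos_sq α
    rw [Complex.mul_im, Complex.inv_re, Complex.inv_im, hne]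
    simp only [Complex.sub_re, Complex.sub_im, Complex.one_re, Complex.one_im, hre, him]
    ring

lemma hasSum_pow_mul_cos_mul_sin {ρ : ℝ} (h0 : 0 < ρ) (h1 : ρ < 1) {x y : ℝ}
    (hx : x ∈ Ioo (-1 : ℝ) 1) (hy : y ∈ Ioo (-1 : ℝ) 1) :
    HasSum (fun n : ℕ => cos ((n + 1 : ℕ) * arccos y) *
        (ρ ^ (n + 1) * sin ((n + 1 : ℕ) * arccos x)))
      (√(1 - x ^ 2) / 2 * conjKernel ((1 - ρ) ^ 2 / (2 * ρ)) x y) := by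
  set θ := arccos x with hθ
  set φ := arccos y with hφ
  have hcx : cos θ = x := cos_arccos hx.1.le hx.2.le
  have hcy : cos φ = y := cos_arccos hy.1.le hy.2.le
  have hsx : sin θ = √(1 - x ^ 2) := sin_arccos x
  have hs := ((hasSum_pow_mul_sin h0 h1 (θ + φ)).add
    (hasSum_pow_mul_sin h0 h1 (θ - φ))).mul_left (1 / 2)
  have hpos (β : ℝ) : 0 < 1 - 2 * ρ * cos β + ρ ^ 2 := by
    nlinarith [mul_le_mul_of_nonneg_left (cos_le_one β) h0.le, mul_pos (sub_pos.2 h1) (sub_pos.2 h1)]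
  have heq (n : ℕ) : cos ((n + 1 : ℕ) * φ) * (ρ ^ (n + 1) * sin ((n + 1 : ℕ) * θ)) =
      1 / 2 * (ρ ^ (n + 1) * sin ((n + 1 : ℕ) * (θ + φ)) +
        ρ ^ (n + 1) * sin ((n + 1 : ℕ) * (θ - φ))) := by
    rw [mul_add (_ : ℝ) θ, mul_sub, sin_add, sin_sub]; ring
  rw [funext heq]
  suffices hv : √(1 - x ^ 2) / 2 * conjKernel ((1 - ρ) ^ 2 / (2 * ρ)) x y = _ by
    rw [hv]; exact hs
  · have hp := hpos (θ + φ)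
    have hm := hpos (θ - φ)
    have hxs : sin θ ^ 2 = 1 - x ^ 2 := by rw [← hcx]; linarith [sin_sq_add_cos_sq θ]
    have hys : sin φ ^ 2 = 1 - y ^ 2 := by rw [← hcy]; linarith [sin_sq_add_cos_sq φ]
    rw [cos_add, hcx, hcy] at hp
    rw [cos_sub, hcx, hcy] at hm
    rw [cos_add, cos_sub, sin_add, sin_sub, ← hsx, hcx, hcy]
    set p := sin θ
    set q := sin φ
    have hD : (1 - 2 * ρ * (x * y - p * q) + ρ ^ 2) * (1 - 2 * ρ * (x * y + p * q) + ρ ^ 2)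
        = 4 * ρ ^ 2 * ((y - x) ^ 2 + (1 - ρ) ^ 2 / (2 * ρ) *
          (2 + (1 - ρ) ^ 2 / (2 * ρ) - 2 * x * y)) := by
      field_simp
      linear_combination (-16 * ρ ^ 2 * q ^ 2) * hxs - 16 * ρ ^ 2 * (1 - x ^ 2) * hys
    have hDpos : 0 < (y - x) ^ 2 + (1 - ρ) ^ 2 / (2 * ρ) *
          (2 + (1 - ρ) ^ 2 / (2 * ρ) - 2 * x * y) := by
      have := mul_pos hp hm
      rw [hD] at this
      exact pos_of_mul_pos_right this (by positivity)
    rw [conjKernel, div_add_div _ _ hp.ne' hm.ne', hD, mul_div_assoc', mul_div_assoc',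
      div_eq_div_iff hDpos.ne' (by positivity)]
    rw [mul_comm (_ / _ * _) (4 * ρ ^ 2 * _), mul_comm (1 / 2 * _) ((y - x) ^ 2 + _)]
    rw [mul_comm (4 * ρ ^ 2), mul_assoc]
    congr 1
    field_simp
    linear_combination (8 * p * ρ * x) * hys

lemma conjKernel_sub_le {x y ε : ℝ} (hx : x ∈ Ioo (-1 : ℝ) 1) (hy : y ∈ Ioo (-1 : ℝ) 1)
    (h0 : 0 < ε) (h1 : ε ≤ 1) :
    |conjKernel (ε ^ 2) x y - (Ioo (x - ε) (x + ε))ᶜ.indicator (fun y => 1 / (y - x)) y|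
      ≤ 14 / (1 - |x|) * (ε / ((y - x) ^ 2 + ε ^ 2)) := by
  have hδ : 0 < 1 - |x| := by rw [sub_pos, abs_lt]; exact hx
  have hδ1 : 1 - |x| ≤ 1 := by linarith [abs_nonneg x]
  have hxy : |x * y| ≤ |x| := by
    rw [abs_mul]; exact mul_le_of_le_one_right (abs_nonneg _) (abs_lt.2 hy).le
  have hxy' := abs_le.1 hxy
  have habs : |y| ≤ 1 := (abs_lt.2 hy).le
  obtain ⟨hy1, hy2⟩ := abs_le.1 habs
  set δ := 1 - |x| with hδd
  set M := 2 + ε ^ 2 - 2 * x * y with hM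
  have hM2 : 2 * δ ≤ M := by nlinarith
  have hM5 : M ≤ 5 := by nlinarith
  set d := y - x with hd
  have hd2 : |d| ≤ 2 := by rw [abs_le]; constructor <;> linarith [hx.1, hx.2, hy.1, hy.2]
  have hDpos : 0 < d ^ 2 + ε ^ 2 * M := by nlinarith [sq_nonneg d, mul_pos (pow_pos h0 2) hδ]
  have hpos : 0 < d ^ 2 + ε ^ 2 := by positivity
  by_cases hin : y ∈ Ioo (x - ε) (x + ε)
  · have hdε : |d| < ε := by rw [abs_lt]; constructor <;> linarith [hin.1, hin.2]
    rw [indicator_of_notMem (by simpa using hin), sub_zero, conjKernel, abs_div,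
      abs_of_pos hDpos, div_mul_div_comm, div_le_div_iff₀ hDpos (by positivity)]
    have hnum : |d + ε ^ 2 * y| ≤ 2 * ε := by
      refine (abs_add_le _ _).trans ?_
      rw [abs_mul, abs_of_pos (pow_pos h0 2)]
      nlinarith [mul_le_mul_of_nonneg_left habs (pow_pos h0 2).le]
    have hdd : d ^ 2 ≤ ε ^ 2 := by rw [← sq_abs d]; gcongr
    calc |d + ε ^ 2 * y| * (δ * (d ^ 2 + ε ^ 2)) ≤ 2 * ε * (δ * (ε ^ 2 + ε ^ 2)) := by gcongr
      _ = 2 * ε * (ε ^ 2 * (2 * δ)) := by ring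
      _ ≤ 2 * ε * (ε ^ 2 * M) := by gcongr
      _ ≤ 14 * ε * (d ^ 2 + ε ^ 2 * M) := by
        nlinarith [sq_nonneg d, mul_pos h0 hDpos, mul_nonneg h0.le (sq_nonneg d)]
  · have hdε : ε ≤ |d| := by
      by_contra! h
      rw [abs_lt] at h
      exact hin ⟨by linarith [h.1], by linarith [h.2]⟩
    have hd0 : 0 < |d| := h0.trans_le hdε
    have hdne : d ≠ 0 := abs_pos.1 hd0
    rw [indicator_of_mem (by simpa using hin), conjKernel]
    have e : (d + ε ^ 2 * y) / (d ^ 2 + ε ^ 2 * M) - 1 / d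
        = ε ^ 2 * (y * d - M) / (d * (d ^ 2 + ε ^ 2 * M)) := by
      field_simp; ring
    rw [e, abs_div, abs_mul, abs_mul, abs_of_pos hDpos, abs_of_pos (pow_pos h0 2),
      div_mul_div_comm, div_le_div_iff₀ (by positivity) (by positivity)]
    have hnum : |y * d - M| ≤ 7 := by
      refine (abs_sub _ _).trans ?_
      rw [abs_mul, abs_of_nonneg (by linarith : 0 ≤ M)]
      nlinarith [mul_le_mul habs hd2 (abs_nonneg _) zero_le_one]
    have hdd : ε ^ 2 ≤ d ^ 2 := by rw [← sq_abs d]; gcongr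
    calc ε ^ 2 * |y * d - M| * (δ * (d ^ 2 + ε ^ 2)) ≤ ε ^ 2 * 7 * (1 * (d ^ 2 + d ^ 2)) := by
          gcongr
      _ = 14 * ε * (ε * d ^ 2) := by ring
      _ ≤ 14 * ε * (|d| * d ^ 2) := by gcongr
      _ ≤ 14 * ε * (|d| * (d ^ 2 + ε ^ 2 * M)) := by
        gcongr
        have := mul_nonneg (sq_nonneg ε) (by linarith : 0 ≤ M)
        linarith

lemma div_sq_add_sq_le_dyadic {d ε : ℝ} (h0 : 0 < ε) :
    ∃ k : ℕ, |d| ≤ 2 ^ k * ε ∧ ε / (d ^ 2 + ε ^ 2) ≤ 4 / ε * (1 / 4) ^ k := by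
  have hex : ∃ k : ℕ, |d| ≤ 2 ^ k * ε := by
    obtain ⟨k, hk⟩ := pow_unbounded_of_one_lt (|d| / ε) (one_lt_two)
    exact ⟨k, ((div_lt_iff₀ h0).1 hk).le⟩
  classical
  refine ⟨Nat.find hex, Nat.find_spec hex, ?_⟩
  have hpos : 0 < d ^ 2 + ε ^ 2 := by positivity
  rcases h : Nat.find hex with _ | k
  · rw [pow_zero, mul_one, div_le_div_iff₀ hpos h0]
    nlinarith [sq_nonneg d]
  · have hk : 2 ^ k * ε < |d| := not_le.1 (Nat.find_min hex (h ▸ Nat.lt_succ_self k))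
    have h2 : (2 ^ k * ε) ^ 2 ≤ d ^ 2 := by rw [← sq_abs d]; gcongr
    have h4 : (2 ^ k * ε) ^ 2 = 4 ^ k * ε ^ 2 := by
      rw [mul_pow, ← pow_mul, mul_comm k 2, pow_mul]; norm_num
    rw [h4] at h2
    calc ε / (d ^ 2 + ε ^ 2) ≤ ε / (4 ^ k * ε ^ 2) := by
          gcongr; nlinarith [sq_nonneg ε]
      _ = 4 / ε * (1 / 4) ^ (k + 1) := by
          rw [one_div, inv_pow, pow_succ]; field_simp; ring

lemma tendsto_integral_mul_poisson {g : ℝ → ℝ} (hg : Integrable g) (hg0 : ∀ y, 0 ≤ g y) {x : ℝ}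
    (h : Tendsto (fun r => r⁻¹ * ∫ y in Metric.closedBall x r, g y) (𝓝[>] 0) (𝓝 0)) :
    Tendsto (fun ε => ∫ y, g y * (ε / ((y - x) ^ 2 + ε ^ 2))) (𝓝[>] 0) (𝓝 0) := by
  set ψ : ℝ → ℝ := fun r => r⁻¹ * ∫ y in Metric.closedBall x r, g y with hψ
  have hψ0 {r : ℝ} (hr : 0 < r) : 0 ≤ ψ r :=
    mul_nonneg (by positivity) (integral_nonneg fun y => hg0 y)
  obtain ⟨B, hB⟩ : ∃ B, ∀ r, 0 < r → ψ r ≤ B := by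
    have h1 := h.eventually_le_const (zero_lt_one' ℝ)
    obtain ⟨r₀, hr₀, hr⟩ := mem_nhdsGT_iff_exists_Ioo_subset.1 h1
    refine ⟨max 1 (r₀⁻¹ * ∫ y, g y), fun r hr0 => ?_⟩
    by_cases hlt : r < r₀
    · exact le_max_of_le_left (hr ⟨hr0, hlt⟩)
    · refine le_max_of_le_right ?_
      refine mul_le_mul (inv_anti₀ (show (0 : ℝ) < r₀ from hr₀) (not_lt.1 hlt))
        (setIntegral_le_integral hg (ae_of_all _ hg0)) (integral_nonneg hg0)
        (inv_nonneg.2 (le_of_lt (show (0 : ℝ) < r₀ from hr₀)))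
  have hsum : Summable fun k : ℕ => 4 * (1 / 2 : ℝ) ^ k * B :=
    ((summable_geometric_two).mul_left 4).mul_right B
  have hlim : Tendsto (fun ε => ∑' k : ℕ, 4 * (1 / 2 : ℝ) ^ k * ψ (2 ^ k * ε)) (𝓝[>] 0) (𝓝 0) := by
    have := tendsto_tsum_of_dominated_convergence (𝓕 := 𝓝[>] (0 : ℝ))
      (f := fun ε (k : ℕ) => 4 * (1 / 2 : ℝ) ^ k * ψ (2 ^ k * ε)) (g := fun _ => 0) hsum
      (fun k => by
        have h2 : Tendsto (fun ε : ℝ => (2 : ℝ) ^ k * ε) (𝓝[>] 0) (𝓝[>] 0) := by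
          refine tendsto_nhdsWithin_iff.2 ⟨?_, ?_⟩
          · refine (Continuous.tendsto' (by fun_prop) _ _ (by simp)).mono_left nhdsWithin_le_nhds
          · filter_upwards [self_mem_nhdsWithin] with ε hε
            exact mul_pos (by positivity) (show (0 : ℝ) < ε from hε)
        simpa using (h.comp h2).const_mul (4 * (1 / 2 : ℝ) ^ k))
      (by
        filter_upwards [self_mem_nhdsWithin] with ε hε k
        have hp : 0 < 2 ^ k * ε := mul_pos (by positivity) hε
        rw [Real.norm_of_nonneg (mul_nonneg (by positivity) (hψ0 hp))]
        have := hB _ hp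
        gcongr)
    simpa using this
  refine squeeze_zero' ?_ ?_ hlim
  · filter_upwards [self_mem_nhdsWithin] with ε hε
    have : 0 < ε := hε
    exact integral_nonneg fun y => mul_nonneg (hg0 y) (by positivity)
  · filter_upwards [self_mem_nhdsWithin] with ε hε
    have h0 : 0 < ε := hε
    set F : ℕ → ℝ → ℝ := fun k => (Metric.closedBall x (2 ^ k * ε)).indicator
      (fun y => 4 / ε * (1 / 4) ^ k * g y) with hF
    have hF0 (k y) : 0 ≤ F k y := indicator_nonneg (fun y _ => mul_nonneg (by positivity) (hg0 y)) y
    have hFle (k y) : F k y ≤ 4 / ε * (1 / 4) ^ k * g y :=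
      indicator_le_self' (fun y _ => mul_nonneg (by positivity) (hg0 y)) y
    have hFint (k) : Integrable (F k) :=
      (hg.const_mul _).indicator Metric.isClosed_closedBall.measurableSet
    have hFI (k) : ∫ y, F k y = 4 * (1 / 2 : ℝ) ^ k * ψ (2 ^ k * ε) := by
      rw [hF, integral_indicator Metric.isClosed_closedBall.measurableSet, integral_const_mul, hψ]
      have : (1 / 4 : ℝ) ^ k = (1 / 2) ^ k * (2 ^ k)⁻¹ := by
        rw [← inv_pow, ← mul_pow]; norm_num
      simp only [mul_inv, this]; ring
    have hFs : Summable fun k => ∫ y, ‖F k y‖ := by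
      simp_rw [Real.norm_of_nonneg (hF0 _ _), hFI]
      refine hsum.of_nonneg_of_le (fun k => mul_nonneg (by positivity) (hψ0 (by positivity)))
        fun k => ?_
      have := hB (2 ^ k * ε) (by positivity)
      gcongr
    have hps (y) : Summable fun k => F k y := by
      refine Summable.of_nonneg_of_le (fun k => hF0 k y) (fun k => hFle k y) ?_
      exact ((summable_geometric_of_lt_one (by norm_num) (by norm_num)).mul_left _).mul_right _
    have hkey := hasSum_integral_of_summable_integral_norm hFint hFs
    simp_rw [← hFI]
    rw [hkey.tsum_eq]
    have hint : Integrable fun y => ∑' k, F k y := by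
      refine (hg.const_mul (∑' k : ℕ, 4 / ε * (1 / 4) ^ k)).mono' ?_ (ae_of_all _ fun y => ?_)
      · exact aestronglyMeasurable_of_tendsto_ae atTop
          (f := fun n y => ∑ k ∈ Finset.range n, F k y)
          (fun n => Finset.aestronglyMeasurable_fun_sum _ fun k _ => (hFint k).1)
          (ae_of_all _ fun y => (hps y).hasSum.tendsto_sum_nat)
      · rw [Real.norm_of_nonneg (tsum_nonneg fun k => hF0 k y), ← tsum_mul_right]
        refine (hps y).tsum_le_tsum (fun k => hFle k y) ?_
        exact ((summable_geometric_of_lt_one (by norm_num) (by norm_num)).mul_left _).mul_right _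
    refine integral_mono_of_nonneg (ae_of_all _ fun y => mul_nonneg (hg0 y) (by positivity)) hint
      (ae_of_all _ fun y => ?_)
    obtain ⟨k, hk1, hk2⟩ := div_sq_add_sq_le_dyadic (d := y - x) h0
    calc g y * (ε / ((y - x) ^ 2 + ε ^ 2)) ≤ g y * (4 / ε * (1 / 4) ^ k) :=
          mul_le_mul_of_nonneg_left hk2 (hg0 y)
      _ = F k y := by
          rw [hF]
          simp only
          rw [indicator_of_mem (by simpa [Real.dist_eq] using hk1)]; ring
      _ ≤ ∑' k, F k y := (hps y).le_tsum k fun j _ => hF0 j y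

lemma integral_indicator_one_div_sub {x ε : ℝ} (h0 : 0 < ε) (h1 : ε < 1 - |x|) :
    ∫ y in Ioo (-1 : ℝ) 1, (Ioo (x - ε) (x + ε))ᶜ.indicator (fun y => 1 / (y - x)) y
      = log (1 - x) - log (1 + x) := by
  have hx1 : x - ε > -1 := by linarith [neg_abs_le x]
  have hx2 : x + ε < 1 := by linarith [le_abs_self x]
  have hset : Ioo (-1 : ℝ) 1 ∩ (Ioo (x - ε) (x + ε))ᶜ = Ioc (-1) (x - ε) ∪ Ico (x + ε) 1 := by
    ext y
    simp only [mem_inter_iff, mem_Ioo, mem_compl_iff, mem_union, mem_Ioc, mem_Ico, not_and_or,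
      not_lt]
    constructor
    · rintro ⟨⟨h1, h2⟩, h | h⟩
      · exact Or.inl ⟨h1, h⟩
      · exact Or.inr ⟨h, h2⟩
    · rintro (⟨h1, h2⟩ | ⟨h1, h2⟩)
      · exact ⟨⟨h1, by linarith⟩, Or.inl h2⟩
      · exact ⟨⟨by linarith, h2⟩, Or.inr h1⟩
  have hi1 : IntervalIntegrable (fun y => 1 / (y - x)) volume (-1) (x - ε) := by
    apply ContinuousOn.intervalIntegrable
    intro y hy
    rw [uIcc_of_le hx1.le] at hy
    have : y - x ≠ 0 := by linarith [hy.2] |> fun h : y - x < 0 => h.ne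
    exact ContinuousAt.continuousWithinAt (by fun_prop (disch := assumption))
  have hi2 : IntervalIntegrable (fun y => 1 / (y - x)) volume (x + ε) 1 := by
    apply ContinuousOn.intervalIntegrable
    intro y hy
    rw [uIcc_of_le hx2.le] at hy
    have : y - x ≠ 0 := by linarith [hy.1] |> fun h : 0 < y - x => h.ne'
    exact ContinuousAt.continuousWithinAt (by fun_prop (disch := assumption))
  rw [setIntegral_indicator measurableSet_Ioo.compl, hset,
    setIntegral_union (by
      rw [Set.disjoint_left]; intro y h1 h2; linarith [h1.2, h2.1]) measurableSet_Ico
      ((intervalIntegrable_iff_integrableOn_Ioc_of_le hx1.le).1 hi1)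
      ((intervalIntegrable_iff_integrableOn_Ico_of_le hx2.le).1 hi2),
    integral_Ico_eq_integral_Ioc, ← intervalIntegral.integral_of_le hx1.le,
    ← intervalIntegral.integral_of_le hx2.le,
    intervalIntegral.integral_comp_sub_right (fun y => 1 / y),
    intervalIntegral.integral_comp_sub_right (fun y => 1 / y),
    integral_one_div_of_neg (by linarith) (by linarith),
    integral_one_div_of_pos (by linarith) (by linarith),
    log_div (by linarith) (by linarith), log_div (by linarith) (by linarith)]
  have e1 : x - ε - x = -ε := by ring
  have e2 : -1 - x = -(1 + x) := by ring
  have e3 : x + ε - x = ε := by ring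
  rw [e1, e2, e3, log_neg_eq_log, log_neg_eq_log]
  ring

lemma conjKernel_denom_eq (τ x y : ℝ) :
    (y - x) ^ 2 + τ * (2 + τ - 2 * x * y)
      = (y - (1 + τ) * x) ^ 2 + ((1 + τ) ^ 2 - 1) * (1 - x ^ 2) := by ring

lemma integral_conjKernel {τ x : ℝ} (hτ : 0 < τ) (hx : x ∈ Ioo (-1 : ℝ) 1) :
    ∫ y in Ioo (-1 : ℝ) 1, conjKernel τ x y
      = (1 + τ) * (log (1 + τ - x) - log (1 + τ + x)) + ∫ y in Ioo (-1 : ℝ) 1,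
        x * (((1 + τ) ^ 2 - 1) / ((y - (1 + τ) * x) ^ 2 + ((1 + τ) ^ 2 - 1) * (1 - x ^ 2))) := by
  set c := 1 + τ with hc
  have hc1 : 0 < c ^ 2 - 1 := by nlinarith
  have hs : 0 < 1 - x ^ 2 := by nlinarith [hx.1, hx.2]
  have hD (y : ℝ) : 0 < (y - c * x) ^ 2 + (c ^ 2 - 1) * (1 - x ^ 2) := by positivity
  have hcont1 : Continuous fun y => c * (y - c * x) / ((y - c * x) ^ 2 + (c ^ 2 - 1) * (1 - x ^ 2)) :=
    by fun_prop (disch := exact fun y => (hD y).ne')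
  have hcont2 : Continuous fun y =>
      x * ((c ^ 2 - 1) / ((y - c * x) ^ 2 + (c ^ 2 - 1) * (1 - x ^ 2))) :=
    by fun_prop (disch := exact fun y => (hD y).ne')
  have hsplit (y : ℝ) : conjKernel τ x y =
      c * (y - c * x) / ((y - c * x) ^ 2 + (c ^ 2 - 1) * (1 - x ^ 2)) +
      x * ((c ^ 2 - 1) / ((y - c * x) ^ 2 + (c ^ 2 - 1) * (1 - x ^ 2))) := by
    rw [conjKernel, conjKernel_denom_eq, mul_div_assoc', ← add_div]
    congr 1
    rw [hc]; ring
  have hle : (-1 : ℝ) ≤ 1 := by norm_num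
  simp_rw [hsplit]
  rw [integral_add
    ((intervalIntegrable_iff_integrableOn_Ioo_of_le hle).1 (hcont1.intervalIntegrable _ _))
    ((intervalIntegrable_iff_integrableOn_Ioo_of_le hle).1 (hcont2.intervalIntegrable _ _))]
  congr 1
  rw [← integral_Ioc_eq_integral_Ioo, ← intervalIntegral.integral_of_le hle,
    intervalIntegral.integral_eq_sub_of_hasDerivAt
      (f := fun y => c / 2 * log ((y - c * x) ^ 2 + (c ^ 2 - 1) * (1 - x ^ 2)))
      (fun y _ => ?_) (hcont1.intervalIntegrable _ _)]
  · have e1 : (1 - c * x) ^ 2 + (c ^ 2 - 1) * (1 - x ^ 2) = (c - x) ^ 2 := by ring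
    have e2 : (-1 - c * x) ^ 2 + (c ^ 2 - 1) * (1 - x ^ 2) = (c + x) ^ 2 := by ring
    simp only [e1, e2, log_pow]
    push_cast; ring
  · have h := (((((hasDerivAt_id y).sub_const (c * x)).pow 2).add_const
      ((c ^ 2 - 1) * (1 - x ^ 2))).log (hD y).ne').const_mul (c / 2)
    have hval : c * (y - c * x) / ((y - c * x) ^ 2 + (c ^ 2 - 1) * (1 - x ^ 2)) =
        c / 2 * ((2 : ℕ) * (y - c * x) ^ (2 - 1) * 1 /
          ((y - c * x) ^ 2 + (c ^ 2 - 1) * (1 - x ^ 2))) := by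
      push_cast
      ring
    rw [hval]
    exact h

lemma tendsto_integral_conjKernel {x : ℝ} (hx : x ∈ Ioo (-1 : ℝ) 1) :
    Tendsto (fun τ => ∫ y in Ioo (-1 : ℝ) 1, conjKernel τ x y) (𝓝[>] 0)
      (𝓝 (log (1 - x) - log (1 + x))) := by
  have hs : 0 < 1 - x ^ 2 := by nlinarith [hx.1, hx.2]
  have hmain : Tendsto (fun τ => (1 + τ) * (log (1 + τ - x) - log (1 + τ + x))) (𝓝[>] 0)
      (𝓝 (log (1 - x) - log (1 + x))) := by
    have h1 : (1 : ℝ) + 0 - x ≠ 0 := by linarith [hx.2] |> fun h : 0 < 1 + 0 - x => h.ne'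
    have h2 : (1 : ℝ) + 0 + x ≠ 0 := by linarith [hx.1] |> fun h : 0 < 1 + 0 + x => h.ne'
    have : ContinuousAt (fun τ => (1 + τ) * (log (1 + τ - x) - log (1 + τ + x))) 0 := by
      fun_prop (disch := assumption)
    have h := this.tendsto
    simp only [add_zero, one_mul] at h
    exact h.mono_left nhdsWithin_le_nhds
  have hrem : Tendsto (fun τ => ∫ y in Ioo (-1 : ℝ) 1,
      x * (((1 + τ) ^ 2 - 1) / ((y - (1 + τ) * x) ^ 2 + ((1 + τ) ^ 2 - 1) * (1 - x ^ 2))))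
      (𝓝[>] 0) (𝓝 (∫ y in Ioo (-1 : ℝ) 1, (0 : ℝ))) := by
    refine tendsto_integral_filter_of_dominated_convergence (fun _ => 1 / (1 - x ^ 2)) ?_ ?_ ?_ ?_
    · exact Eventually.of_forall fun τ => (by measurability : Measurable _).aestronglyMeasurable
    · filter_upwards [self_mem_nhdsWithin] with τ hτ
      refine ae_of_all _ fun y => ?_
      have hτ' : 0 < τ := hτ
      have hc1 : 0 < (1 + τ) ^ 2 - 1 := by nlinarith
      rw [norm_mul, Real.norm_eq_abs, Real.norm_of_nonneg (by positivity)]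
      refine (mul_le_of_le_one_left (by positivity) (abs_lt.2 hx).le).trans ?_
      rw [div_le_div_iff₀ (by positivity) hs]
      nlinarith [sq_nonneg (y - (1 + τ) * x)]
    · exact integrable_const _
    · refine ae_restrict_of_ae ?_
      filter_upwards [Measure.ae_ne volume x] with y hy
      have h1 : (y - (1 + 0) * x) ^ 2 + ((1 + 0) ^ 2 - 1) * (1 - x ^ 2) ≠ 0 := by
        simp [sub_ne_zero.2 hy]
      have : ContinuousAt (fun τ => x * (((1 + τ) ^ 2 - 1) /
          ((y - (1 + τ) * x) ^ 2 + ((1 + τ) ^ 2 - 1) * (1 - x ^ 2)))) 0 := by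
        fun_prop (disch := assumption)
      have h := this.tendsto
      simp only [add_zero, one_mul, one_pow, sub_self, zero_div, mul_zero] at h
      exact h.mono_left nhdsWithin_le_nhds
  have := hmain.add hrem
  rw [integral_zero, add_zero] at this
  refine this.congr' ?_
  filter_upwards [self_mem_nhdsWithin] with τ hτ
  exact (integral_conjKernel hτ hx).symm

lemma measurable_conjKernel (τ x : ℝ) : Measurable (conjKernel τ x) := by
  unfold conjKernel
  fun_prop

lemma measurable_indicator_one_div_sub (x ε : ℝ) :
    Measurable ((Ioo (x - ε) (x + ε))ᶜ.indicator fun y => 1 / (y - x)) :=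
  Measurable.indicator (by fun_prop) measurableSet_Ioo.compl

lemma tendsto_integral_mul_conjKernel {f : ℝ → ℝ} (hf : IntegrableOn f (Ioo (-1 : ℝ) 1)) {x : ℝ}
    (hx : x ∈ Ioo (-1 : ℝ) 1)
    (hleb : Tendsto (fun r => r⁻¹ * ∫ y in Metric.closedBall x r,
      (Ioo (-1 : ℝ) 1).indicator (fun y => |f y - f x|) y) (𝓝[>] 0) (𝓝 0))
    (hH : HasFiniteHilbertAt f x 0) :
    Tendsto (fun ε => ∫ y in Ioo (-1 : ℝ) 1, f y * conjKernel (ε ^ 2) x y) (𝓝[>] 0) (𝓝 0) := by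
  have hδ : 0 < 1 - |x| := by rw [sub_pos, abs_lt]; exact hx
  set J : ℝ → ℝ → ℝ := fun ε => (Ioo (x - ε) (x + ε))ᶜ.indicator fun y => 1 / (y - x) with hJ
  have hfx : IntegrableOn (fun y => f y - f x) (Ioo (-1 : ℝ) 1) :=
    hf.sub (integrable_const (f x))
  have hsmall : ∀ᶠ ε in 𝓝[>] (0 : ℝ), 0 < ε ∧ ε < 1 - |x| := Ioo_mem_nhdsGT hδ
  have hE (ε : ℝ) (h0 : 0 < ε) (h1 : ε < 1 - |x|) : ∀ᵐ y ∂(volume.restrict (Ioo (-1 : ℝ) 1)),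
      ‖conjKernel (ε ^ 2) x y - J ε y‖ ≤ 14 / (1 - |x|) * (ε / ((y - x) ^ 2 + ε ^ 2)) := by
    filter_upwards [ae_restrict_mem measurableSet_Ioo] with y hy
    exact conjKernel_sub_le hx hy h0 (by linarith [abs_nonneg x])
  have hEm (ε : ℝ) : AEStronglyMeasurable (fun y => conjKernel (ε ^ 2) x y - J ε y)
      (volume.restrict (Ioo (-1 : ℝ) 1)) :=
    ((measurable_conjKernel _ _).sub (measurable_indicator_one_div_sub _ _)).aestronglyMeasurable
  have hEb (ε : ℝ) (h0 : 0 < ε) (h1 : ε < 1 - |x|) : ∀ᵐ y ∂(volume.restrict (Ioo (-1 : ℝ) 1)),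
      ‖conjKernel (ε ^ 2) x y - J ε y‖ ≤ 14 / (1 - |x|) * (ε / ε ^ 2) := by
    filter_upwards [hE ε h0 h1] with y hy
    refine hy.trans ?_
    gcongr
    nlinarith [sq_nonneg (y - x)]
  have hJb (ε : ℝ) (h0 : 0 < ε) : ∀ᵐ y ∂(volume.restrict (Ioo (-1 : ℝ) 1)),
      ‖J ε y‖ ≤ 1 / ε := by
    refine ae_of_all _ fun y => ?_
    by_cases hy : y ∈ Ioo (x - ε) (x + ε)
    · simp only [hJ]
      rw [indicator_of_notMem (by simpa using hy), norm_zero]; positivity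
    · simp only [hJ]
      rw [indicator_of_mem (by simpa using hy), norm_div, norm_one, Real.norm_eq_abs]
      gcongr
      by_contra! h
      rw [abs_lt] at h
      exact hy ⟨by linarith [h.1], by linarith [h.2]⟩
  have hJm (ε : ℝ) : AEStronglyMeasurable (J ε) (volume.restrict (Ioo (-1 : ℝ) 1)) :=
    (measurable_indicator_one_div_sub _ _).aestronglyMeasurable
  have hdecomp : ∀ᶠ ε in 𝓝[>] (0 : ℝ), (∫ y in Ioo (-1 : ℝ) 1, (f y - f x) *
      (conjKernel (ε ^ 2) x y - J ε y)) + -π * truncatedFiniteHilbert f x ε + f x *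
      ((∫ y in Ioo (-1 : ℝ) 1, conjKernel (ε ^ 2) x y) - (log (1 - x) - log (1 + x)))
      = ∫ y in Ioo (-1 : ℝ) 1, f y * conjKernel (ε ^ 2) x y := by
    filter_upwards [hsmall] with ε ⟨h0, h1⟩
    have hEi : IntegrableOn (fun y => conjKernel (ε ^ 2) x y - J ε y) (Ioo (-1 : ℝ) 1) :=
      (integrable_const _).mono' (hEm ε) (hEb ε h0 h1)
    have hJi : IntegrableOn (J ε) (Ioo (-1 : ℝ) 1) :=
      (integrable_const _).mono' (hJm ε) (hJb ε h0)
    have hKi : IntegrableOn (conjKernel (ε ^ 2) x) (Ioo (-1 : ℝ) 1) := by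
      refine (hEi.add hJi).congr (ae_of_all _ fun y => ?_)
      simp
    have hfE := hfx.mul_bdd (hEm ε) (hEb ε h0 h1)
    have hfJ := hf.mul_bdd (hJm ε) (hJb ε h0)
    have htr : -π * truncatedFiniteHilbert f x ε = ∫ y in Ioo (-1 : ℝ) 1, f y * J ε y := by
      have e (y : ℝ) : f y * J ε y =
          (Ioo (x - ε) (x + ε))ᶜ.indicator (fun y => -(f y / (x - y))) y := by
        simp only [hJ, indicator_apply]
        split_ifs
        · rw [← neg_sub y x, div_neg]; ring
        · simp
      simp_rw [e]
      rw [setIntegral_indicator measurableSet_Ioo.compl, integral_neg, truncatedFiniteHilbert,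
        ← sdiff_eq]
      field_simp
    rw [htr, ← integral_indicator_one_div_sub h0 h1, ← integral_sub hKi hJi,
      ← integral_const_mul, ← integral_add hfE hfJ, ←
      integral_add (by exact hfE.add hfJ) (hEi.const_mul _)]
    congr 1 with y
    ring
  have hK : Tendsto (fun ε : ℝ => ∫ y in Ioo (-1 : ℝ) 1, conjKernel (ε ^ 2) x y) (𝓝[>] 0)
      (𝓝 (log (1 - x) - log (1 + x))) := by
    refine (tendsto_integral_conjKernel hx).comp (tendsto_nhdsWithin_iff.2 ⟨?_, ?_⟩)
    · exact (Continuous.tendsto' (by fun_prop) _ _ (by simp)).mono_left nhdsWithin_le_nhds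
    · filter_upwards [self_mem_nhdsWithin] with ε hε
      exact pow_pos (show (0 : ℝ) < ε from hε) 2
  have hT : Tendsto (fun ε => -π * truncatedFiniteHilbert f x ε) (𝓝[>] 0) (𝓝 (-π * 0)) :=
    Tendsto.const_mul _ hH
  have hP : Tendsto (fun ε => ∫ y in Ioo (-1 : ℝ) 1, (f y - f x) *
      (conjKernel (ε ^ 2) x y - J ε y)) (𝓝[>] 0) (𝓝 0) := by
    have hgi : Integrable ((Ioo (-1 : ℝ) 1).indicator fun y => |f y - f x|) :=
      (integrable_indicator_iff measurableSet_Ioo).2 hfx.abs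
    have hp := (tendsto_integral_mul_poisson hgi
      (indicator_nonneg fun y _ => abs_nonneg _) hleb).const_mul (14 / (1 - |x|))
    rw [mul_zero] at hp
    refine squeeze_zero_norm' ?_ hp
    filter_upwards [hsmall] with ε ⟨h0, h1⟩
    refine (norm_integral_le_integral_norm _).trans ?_
    rw [← integral_const_mul]
    have e (y : ℝ) : 14 / (1 - |x|) * ((Ioo (-1 : ℝ) 1).indicator (fun y => |f y - f x|) y *
        (ε / ((y - x) ^ 2 + ε ^ 2))) = (Ioo (-1 : ℝ) 1).indicator (fun y => |f y - f x| *
        (14 / (1 - |x|) * (ε / ((y - x) ^ 2 + ε ^ 2)))) y := by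
      simp only [indicator_apply]
      split_ifs
      · ring
      · simp
    simp_rw [e]
    rw [integral_indicator measurableSet_Ioo]
    refine integral_mono_ae (hfx.mul_bdd (hEm ε) (hEb ε h0 h1)).norm
      (hfx.abs.mul_bdd (c := 14 / (1 - |x|) * (ε / ε ^ 2))
        (Measurable.aestronglyMeasurable (by fun_prop)) (ae_of_all _ fun y => ?_)) ?_
    · rw [Real.norm_of_nonneg (by positivity)]
      gcongr
      nlinarith [sq_nonneg (y - x)]
    · filter_upwards [hE ε h0 h1] with y hy
      rw [norm_mul]
      exact mul_le_mul_of_nonneg_left hy (norm_nonneg _)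
  have := (hP.add hT).add ((hK.sub_const (log (1 - x) - log (1 + x))).const_mul (f x))
  simp only [mul_zero, sub_self, add_zero] at this
  exact this.congr' hdecomp

lemma ae_tendsto_inv_mul_integral_closedBall {f : ℝ → ℝ} (hf : IntegrableOn f (Ioo (-1 : ℝ) 1)) :
    ∀ᵐ x ∂(volume.restrict (Ioo (-1 : ℝ) 1)),
      Tendsto (fun r => r⁻¹ * ∫ y in Metric.closedBall x r,
        (Ioo (-1 : ℝ) 1).indicator (fun y => |f y - f x|) y) (𝓝[>] 0) (𝓝 0) := by
  have hF : Integrable ((Ioo (-1 : ℝ) 1).indicator f) :=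
    (integrable_indicator_iff measurableSet_Ioo).2 hf
  filter_upwards [ae_restrict_mem measurableSet_Ioo, ae_restrict_of_ae
    (IsUnifLocDoublingMeasure.ae_tendsto_average_norm_sub volume hF.locallyIntegrable 1)]
    with x hx h
  have h1 := (h (l := 𝓝[>] (0 : ℝ)) (fun _ => x) id tendsto_id (by
    filter_upwards [self_mem_nhdsWithin] with r hr
    simpa using (show (0 : ℝ) < r from hr).le)).const_mul 2
  rw [mul_zero] at h1
  have hind (y : ℝ) : (Ioo (-1 : ℝ) 1).indicator (fun y => |f y - f x|) y ≤
      ‖(Ioo (-1 : ℝ) 1).indicator f y - (Ioo (-1 : ℝ) 1).indicator f x‖ := by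
    by_cases hy : y ∈ Ioo (-1 : ℝ) 1
    · simp [indicator_of_mem hy, indicator_of_mem hx]
    · rw [indicator_of_notMem hy]; exact norm_nonneg _
  have hind0 (y : ℝ) : 0 ≤ (Ioo (-1 : ℝ) 1).indicator (fun y => |f y - f x|) y :=
    indicator_nonneg (fun _ _ => abs_nonneg _) _
  refine squeeze_zero' ?_ ?_ h1
  · filter_upwards [self_mem_nhdsWithin] with r hr
    have hr' : (0 : ℝ) < r := hr
    exact mul_nonneg (by positivity) (integral_nonneg hind0)
  · filter_upwards [self_mem_nhdsWithin] with r hr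
    have hr' : (0 : ℝ) < r := hr
    rw [setAverage_eq, id, Real.volume_real_closedBall hr'.le, smul_eq_mul, ← mul_assoc,
      mul_inv, mul_inv_cancel_left₀ two_ne_zero]
    refine mul_le_mul_of_nonneg_left (integral_mono_of_nonneg (ae_of_all _ hind0) ?_
      (ae_of_all _ hind)) (by positivity)
    exact (hF.integrableOn.sub (integrableOn_const measure_closedBall_lt_top.ne)).norm

/-- The cosine moment of `f` of order `n + 1`, in the variable `arccos`. -/
noncomputable def cosMoment (f : ℝ → ℝ) (n : ℕ) : ℝ :=
  ∫ y in Ioo (-1 : ℝ) 1, f y * cos ((n + 1 : ℕ) * arccos y)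

lemma integrableOn_mul_cos {f : ℝ → ℝ} (hf : IntegrableOn f (Ioo (-1 : ℝ) 1)) (n : ℕ) :
    IntegrableOn (fun y => f y * cos ((n + 1 : ℕ) * arccos y)) (Ioo (-1 : ℝ) 1) := by
  have := continuous_arccos
  exact Integrable.mul_bdd (c := 1) hf
    (Continuous.aestronglyMeasurable (by fun_prop)) (ae_of_all _ fun y => abs_cos_le_one _)

lemma abs_cosMoment_le {f : ℝ → ℝ} (hf : IntegrableOn f (Ioo (-1 : ℝ) 1)) (n : ℕ) :
    |cosMoment f n| ≤ ∫ y in Ioo (-1 : ℝ) 1, |f y| := by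
  rw [cosMoment, ← Real.norm_eq_abs]
  refine norm_integral_le_of_norm_le hf.abs (ae_of_all _ fun y => ?_)
  rw [norm_mul]
  exact mul_le_of_le_one_right (abs_nonneg _) (abs_cos_le_one _)

lemma summable_abs_cosMoment_mul_pow {f : ℝ → ℝ} (hf : IntegrableOn f (Ioo (-1 : ℝ) 1)) {ρ : ℝ}
    (h0 : 0 < ρ) (h1 : ρ < 1) : Summable fun n => |cosMoment f n * ρ ^ (n + 1)| := by
  have hs : Summable fun n : ℕ => (∫ y in Ioo (-1 : ℝ) 1, |f y|) * ρ ^ (n + 1) :=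
    ((summable_nat_add_iff 1).2 (summable_geometric_of_lt_one h0.le h1)).mul_left _
  refine hs.of_nonneg_of_le (fun n => abs_nonneg _) fun n => ?_
  rw [abs_mul, abs_of_pos (pow_pos h0 _)]
  gcongr
  exact abs_cosMoment_le hf n

lemma tsum_cosMoment_mul_pow_mul_sin {f : ℝ → ℝ} (hf : IntegrableOn f (Ioo (-1 : ℝ) 1)) {ρ : ℝ}
    (h0 : 0 < ρ) (h1 : ρ < 1) {x : ℝ} (hx : x ∈ Ioo (-1 : ℝ) 1) :
    ∑' n, cosMoment f n * ρ ^ (n + 1) * sin ((n + 1 : ℕ) * arccos x) = √(1 - x ^ 2) / 2 *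
      ∫ y in Ioo (-1 : ℝ) 1, f y * conjKernel ((1 - ρ) ^ 2 / (2 * ρ)) x y := by
  have key := hasSum_integral_of_dominated_convergence (μ := volume.restrict (Ioo (-1 : ℝ) 1))
    (F := fun n y => f y * cos ((n + 1 : ℕ) * arccos y) *
      (ρ ^ (n + 1) * sin ((n + 1 : ℕ) * arccos x)))
    (f := fun y => f y * (√(1 - x ^ 2) / 2 * conjKernel ((1 - ρ) ^ 2 / (2 * ρ)) x y))
    (fun n y => |f y| * ρ ^ (n + 1))
    (fun n => ((integrableOn_mul_cos hf n).mul_const _).1)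
    (fun n => ae_of_all _ fun y => by
      rw [norm_mul, norm_mul, norm_mul, Real.norm_of_nonneg (pow_pos h0 _).le]
      refine mul_le_mul (mul_le_of_le_one_right (abs_nonneg _) (abs_cos_le_one _))
        (mul_le_of_le_one_right (by positivity) (abs_sin_le_one _)) (by positivity)
        (abs_nonneg _))
    (ae_of_all _ fun y =>
      ((summable_nat_add_iff 1).2 (summable_geometric_of_lt_one h0.le h1)).mul_left _)
    (by
      simp_rw [tsum_mul_left]
      exact hf.abs.mul_const _)
    (by
      filter_upwards [ae_restrict_mem measurableSet_Ioo] with y hy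
      simpa only [mul_assoc] using (hasSum_pow_mul_cos_mul_sin h0 h1 hx hy).mul_left (f y))
  have e : ∫ y in Ioo (-1 : ℝ) 1, f y * (√(1 - x ^ 2) / 2 *
      conjKernel ((1 - ρ) ^ 2 / (2 * ρ)) x y) = √(1 - x ^ 2) / 2 *
      ∫ y in Ioo (-1 : ℝ) 1, f y * conjKernel ((1 - ρ) ^ 2 / (2 * ρ)) x y := by
    rw [← integral_const_mul]; congr 1 with y; ring
  rw [e] at key
  rw [← key.tsum_eq]
  simp_rw [integral_mul_const, mul_assoc]
  rfl

lemma sum_cosMoment_sq_le {f : ℝ → ℝ} (hf : IntegrableOn f (Ioo (-1 : ℝ) 1))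
    (hL2 : IntegrableOn (fun x => f x ^ 2 * √(1 - x ^ 2)) (Ioo (-1 : ℝ) 1)) (N : ℕ) :
    ∑ n ∈ Finset.range N, cosMoment f n ^ 2
      ≤ π / 2 * ∫ x in Ioo (-1 : ℝ) 1, f x ^ 2 * √(1 - x ^ 2) := by
  have hac := continuous_arccos
  set σ := ∑ n ∈ Finset.range N, cosMoment f n ^ 2 with hσ
  set P : ℝ → ℝ := fun x => ∑ n ∈ Finset.range N, cosMoment f n * cos ((n + 1 : ℕ) * arccos x)
    with hP
  have hPc : Continuous P := by fun_prop
  have hfP : ∫ x in Ioo (-1 : ℝ) 1, f x * P x = σ := by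
    simp_rw [hP, Finset.mul_sum]
    rw [integral_finsetSum _ fun n _ => by
      simpa only [mul_left_comm] using (integrableOn_mul_cos hf n).const_mul (cosMoment f n)]
    refine Finset.sum_congr rfl fun n _ => ?_
    simp_rw [mul_left_comm (f _)]
    rw [integral_const_mul, sq]; rfl
  have hfPi : IntegrableOn (fun x => f x * P x) (Ioo (-1 : ℝ) 1) := by
    simp_rw [hP, Finset.mul_sum]
    refine integrable_finsetSum _ fun n _ => ?_
    simpa only [mul_left_comm] using (integrableOn_mul_cos hf n).const_mul (cosMoment f n)
  have hw : IntegrableOn (fun x => P x ^ 2 * √(1 - x ^ 2)⁻¹) (Ioo (-1 : ℝ) 1) :=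
    (intervalIntegrable_iff_integrableOn_Ioo_of_le (by norm_num)).1
      (Polynomial.Chebyshev.intervalIntegrable_sqrt_one_sub_sq_inv.continuousOn_mul
        (hPc.pow 2).continuousOn)
  have hPP : ∫ x in Ioo (-1 : ℝ) 1, P x ^ 2 * √(1 - x ^ 2)⁻¹ = π / 2 * σ := by
    rw [← integral_Ioc_eq_integral_Ioo, ← intervalIntegral.integral_of_le (by norm_num),
      ← Polynomial.Chebyshev.integral_measureT (fun x => P x ^ 2)]
    have hi (m n : ℕ) : Integrable (fun x => cosMoment f m * cos ((m + 1 : ℕ) * arccos x) *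
        (cosMoment f n * cos ((n + 1 : ℕ) * arccos x))) measureT :=
      Polynomial.Chebyshev.integrable_measureT (Continuous.continuousOn (by fun_prop))
    simp_rw [hP, sq, Finset.sum_mul_sum]
    rw [integral_finsetSum _ fun m _ => integrable_finsetSum _ fun n _ => hi m n, hσ,
      Finset.mul_sum]
    refine Finset.sum_congr rfl fun m hm => ?_
    rw [integral_finsetSum _ fun n _ => hi m n]
    simp_rw [mul_mul_mul_comm (cosMoment f m)]
    simp_rw [integral_const_mul, integral_cos_mul_cos_measureT]
    simp only [mul_ite, mul_zero, Finset.sum_ite_eq, hm, if_true]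
    ring
  have hnn : 0 ≤ ∫ x in Ioo (-1 : ℝ) 1, (f x ^ 2 * √(1 - x ^ 2) - 4 / π * (f x * P x) +
      4 / π ^ 2 * (P x ^ 2 * √(1 - x ^ 2)⁻¹)) := by
    refine integral_nonneg_of_ae ?_
    filter_upwards [ae_restrict_mem measurableSet_Ioo] with x hx
    have hs : 0 < √(1 - x ^ 2) := Real.sqrt_pos.2 (by nlinarith [hx.1, hx.2])
    have : f x ^ 2 * √(1 - x ^ 2) - 4 / π * (f x * P x) + 4 / π ^ 2 * (P x ^ 2 * √(1 - x ^ 2)⁻¹)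
        = (f x * √(1 - x ^ 2) - 2 / π * P x) ^ 2 * (√(1 - x ^ 2))⁻¹ := by
      rw [Real.sqrt_inv]
      field_simp
      ring
    simp only [Pi.zero_apply, this]
    positivity
  rw [integral_add (by exact hL2.sub (hfPi.const_mul _)) (hw.const_mul _),
    integral_sub hL2 (hfPi.const_mul _), integral_const_mul, integral_const_mul, hfP, hPP] at hnn
  have e : 4 / π ^ 2 * (π / 2 * σ) = 2 / π * σ := by field_simp; norm_num
  rw [e] at hnn
  have h3 : 2 / π * σ ≤ ∫ x in Ioo (-1 : ℝ) 1, f x ^ 2 * √(1 - x ^ 2) := by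
    have : 4 / π * σ = 2 * (2 / π * σ) := by ring
    linarith
  calc σ = π / 2 * (2 / π * σ) := by field_simp
    _ ≤ _ := by gcongr

lemma integral_le_of_ae_tendsto {α : Type*} {mα : MeasurableSpace α} {μ : Measure α}
    {F : ℕ → α → ℝ} {g : α → ℝ} (hF : ∀ k, Integrable (F k) μ) (hF0 : ∀ k x, 0 ≤ F k x)
    (hg : Integrable g μ) (hg0 : ∀ x, 0 ≤ g x)
    (hlim : ∀ᵐ x ∂μ, Tendsto (fun k => F k x) atTop (𝓝 (g x)))
    {C : ℝ} (hC : ∀ᶠ k in atTop, ∫ x, F k x ∂μ ≤ C) : ∫ x, g x ∂μ ≤ C := by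
  have hC0 : 0 ≤ C := by
    obtain ⟨k, hk⟩ := hC.exists
    exact (integral_nonneg (hF0 k)).trans hk
  rw [← ENNReal.ofReal_le_ofReal_iff hC0,
    ofReal_integral_eq_lintegral_ofReal hg (ae_of_all _ hg0)]
  calc ∫⁻ x, ENNReal.ofReal (g x) ∂μ
      = ∫⁻ x, liminf (fun k => ENNReal.ofReal (F k x)) atTop ∂μ := by
        refine lintegral_congr_ae ?_
        filter_upwards [hlim] with x hx
        exact ((ENNReal.continuous_ofReal.tendsto _).comp hx).liminf_eq.symm
    _ ≤ liminf (fun k => ∫⁻ x, ENNReal.ofReal (F k x) ∂μ) atTop :=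
        lintegral_liminf_le' fun k => (hF k).1.aemeasurable.ennreal_ofReal
    _ ≤ ENNReal.ofReal C := by
        refine liminf_le_of_frequently_le' (Eventually.frequently ?_)
        filter_upwards [hC] with k hk
        rw [← ofReal_integral_eq_lintegral_ofReal (hF k) (ae_of_all _ (hF0 k))]
        exact ENNReal.ofReal_le_ofReal hk

lemma integral_mul_eval_eq_zero {f : ℝ → ℝ} (hf : IntegrableOn f (Ioo (-1 : ℝ) 1))
    (hmean : ∫ x in Ioo (-1 : ℝ) 1, f x = 0) (hmom : ∀ n, cosMoment f n = 0)
    (p : Polynomial ℝ) : ∫ x in Ioo (-1 : ℝ) 1, f x * p.eval x = 0 := by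
  have hint (q : Polynomial ℝ) : IntegrableOn (fun x => f x * q.eval x) (Ioo (-1 : ℝ) 1) := by
    refine IntegrableOn.mul_continuousOn_of_subset hf (K := Icc (-1) 1) ?_ measurableSet_Ioo
      isCompact_Icc Ioo_subset_Icc_self
    exact q.continuous.continuousOn
  have hT (n : ℕ) : ∫ x in Ioo (-1 : ℝ) 1, f x * (Polynomial.Chebyshev.T ℝ n).eval x = 0 := by
    rcases n with _ | n
    · simpa using hmean
    · rw [← hmom n, cosMoment]
      refine setIntegral_congr_fun measurableSet_Ioo fun x hx => ?_
      conv_lhs => rw [← cos_arccos hx.1.le hx.2.le, Polynomial.Chebyshev.T_real_cos,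
        cos_arccos hx.1.le hx.2.le]
      simp
  have hTz (n : ℤ) : ∫ x in Ioo (-1 : ℝ) 1, f x * (Polynomial.Chebyshev.T ℝ n).eval x = 0 := by
    rw [← Polynomial.Chebyshev.T_natAbs]; exact hT _
  have hpow (k : ℕ) : ∀ n : ℤ, ∫ x in Ioo (-1 : ℝ) 1,
      f x * (Polynomial.X ^ k * Polynomial.Chebyshev.T ℝ n).eval x = 0 := by
    induction k with
    | zero => simpa using hTz
    | succ k ih =>
      intro n
      have h1 := ih (n + 1)
      have h2 := ih (n - 1)
      have e (x : ℝ) : f x * (Polynomial.X ^ (k + 1) * Polynomial.Chebyshev.T ℝ n).eval x =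
          1 / 2 * (f x * (Polynomial.X ^ k * Polynomial.Chebyshev.T ℝ (n + 1)).eval x +
            f x * (Polynomial.X ^ k * Polynomial.Chebyshev.T ℝ (n - 1)).eval x) := by
        rw [Polynomial.Chebyshev.T_add_one]
        simp only [Polynomial.eval_mul, Polynomial.eval_pow, Polynomial.eval_X,
          Polynomial.eval_sub, Polynomial.eval_ofNat]
        ring
      simp_rw [e]
      rw [integral_const_mul, integral_add (hint _) (hint _), h1, h2]
      simp
  induction p using Polynomial.induction_on' with
  | add p q hp hq =>
    simp_rw [Polynomial.eval_add, mul_add]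
    rw [integral_add (hint p) (hint q), hp, hq, add_zero]
  | monomial k a =>
    have := hpow k 0
    simp only [Polynomial.Chebyshev.T_zero, mul_one, Polynomial.eval_pow, Polynomial.eval_X] at this
    simp_rw [Polynomial.eval_monomial, mul_left_comm]
    rw [integral_const_mul, this, mul_zero]

lemma ae_eq_zero_of_integral_mul_eval_eq_zero {f : ℝ → ℝ} (hf : IntegrableOn f (Ioo (-1 : ℝ) 1))
    (h : ∀ p : Polynomial ℝ, ∫ x in Ioo (-1 : ℝ) 1, f x * p.eval x = 0) :
    ∀ᵐ x ∂(volume.restrict (Ioo (-1 : ℝ) 1)), f x = 0 := by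
  rw [ae_restrict_iff' measurableSet_Ioo]
  refine isOpen_Ioo.ae_eq_zero_of_integral_contDiff_smul_eq_zero hf.locallyIntegrableOn
    fun g hg _ hsupp => ?_
  have hset : ∫ x, g x • f x = ∫ x in Ioo (-1 : ℝ) 1, f x * g x := by
    rw [← setIntegral_eq_integral_of_forall_compl_eq_zero (s := Ioo (-1 : ℝ) 1)]
    · simp_rw [smul_eq_mul, mul_comm]
    · intro x hx
      rw [image_eq_zero_of_notMem_tsupport fun hx' => hx (hsupp hx'), zero_smul]
  rw [hset, ← abs_eq_zero]
  have hcont : ContinuousOn g (Icc (-1) 1) := hg.continuous.continuousOn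
  have hfg : IntegrableOn (fun x => f x * g x) (Ioo (-1 : ℝ) 1) :=
    IntegrableOn.mul_continuousOn_of_subset hf hcont measurableSet_Ioo
      isCompact_Icc Ioo_subset_Icc_self
  have hle (η : ℝ) (hη : 0 < η) : |∫ x in Ioo (-1 : ℝ) 1, f x * g x|
      ≤ η * ∫ x in Ioo (-1 : ℝ) 1, |f x| := by
    obtain ⟨p, hp⟩ := exists_polynomial_near_of_continuousOn (-1) 1 g hcont η hη
    have hfp : IntegrableOn (fun x => f x * p.eval x) (Ioo (-1 : ℝ) 1) :=
      IntegrableOn.mul_continuousOn_of_subset hf p.continuous.continuousOn measurableSet_Ioo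
        isCompact_Icc Ioo_subset_Icc_self
    rw [← sub_zero (∫ x in Ioo (-1 : ℝ) 1, f x * g x), ← h p, ← integral_sub hfg hfp,
      ← integral_const_mul]
    rw [← Real.norm_eq_abs]
    refine norm_integral_le_of_norm_le (hf.abs.const_mul η) ?_
    filter_upwards [ae_restrict_mem measurableSet_Ioo] with x hx
    rw [← mul_sub, norm_mul, mul_comm, Real.norm_eq_abs, Real.norm_eq_abs, abs_sub_comm]
    exact mul_le_mul_of_nonneg_right (hp x (Ioo_subset_Icc_self hx)).le (abs_nonneg _)
  refine le_antisymm (ge_of_tendsto (x := 𝓝[>] (0 : ℝ)) (f := fun η : ℝ =>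
    η * ∫ x in Ioo (-1 : ℝ) 1, |f x|) ?_ ?_) (abs_nonneg _)
  · exact (Continuous.tendsto' (by fun_prop) _ _ (by simp)).mono_left nhdsWithin_le_nhds
  · filter_upwards [self_mem_nhdsWithin] with η hη
    exact hle η hη

lemma tendsto_tsum_cosMoment_mul_pow_mul_sin {f : ℝ → ℝ} (hf : IntegrableOn f (Ioo (-1 : ℝ) 1))
    {x : ℝ} (hx : x ∈ Ioo (-1 : ℝ) 1)
    (hleb : Tendsto (fun r => r⁻¹ * ∫ y in Metric.closedBall x r,
      (Ioo (-1 : ℝ) 1).indicator (fun y => |f y - f x|) y) (𝓝[>] 0) (𝓝 0))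
    (hH : HasFiniteHilbertAt f x 0) :
    Tendsto (fun ρ => ∑' n, cosMoment f n * ρ ^ (n + 1) * sin ((n + 1 : ℕ) * arccos x))
      (𝓝[<] 1) (𝓝 0) := by
  have hρ : ∀ᶠ ρ in 𝓝[<] (1 : ℝ), 0 < ρ ∧ ρ < 1 := Ioo_mem_nhdsLT one_pos
  have hε : Tendsto (fun ρ : ℝ => (1 - ρ) / √(2 * ρ)) (𝓝[<] 1) (𝓝[>] 0) := by
    refine tendsto_nhdsWithin_iff.2 ⟨?_, ?_⟩
    · have h2 : √(2 * (1 : ℝ)) ≠ 0 := by positivity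
      have : ContinuousAt (fun ρ : ℝ => (1 - ρ) / √(2 * ρ)) 1 := by fun_prop (disch := assumption)
      simpa using this.tendsto.mono_left nhdsWithin_le_nhds
    · filter_upwards [hρ] with ρ ⟨h0, h1⟩
      exact div_pos (sub_pos.2 h1) (Real.sqrt_pos.2 (by positivity))
  have h := ((tendsto_integral_mul_conjKernel hf hx hleb hH).comp hε).const_mul
    (√(1 - x ^ 2) / 2)
  rw [mul_zero] at h
  refine h.congr' ?_
  filter_upwards [hρ] with ρ ⟨h0, h1⟩
  rw [tsum_cosMoment_mul_pow_mul_sin hf h0 h1 hx, Function.comp_apply, div_pow,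
    Real.sq_sqrt (by positivity)]

lemma summable_cosMoment_sq {f : ℝ → ℝ} (hf : IntegrableOn f (Ioo (-1 : ℝ) 1))
    (hL2 : IntegrableOn (fun x => f x ^ 2 * √(1 - x ^ 2)) (Ioo (-1 : ℝ) 1)) :
    Summable fun n => cosMoment f n ^ 2 :=
  summable_of_sum_range_le (fun _ => sq_nonneg _) (sum_cosMoment_sq_le hf hL2)

lemma tsum_cosMoment_sq_mul_le {f : ℝ → ℝ} (hf : IntegrableOn f (Ioo (-1 : ℝ) 1))
    (hL2 : IntegrableOn (fun x => f x ^ 2 * √(1 - x ^ 2)) (Ioo (-1 : ℝ) 1))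
    (hH : ∀ᵐ x ∂(volume.restrict (Ioo (-1 : ℝ) 1)), HasFiniteHilbertAt f x 0)
    {σ : ℝ} (h0 : 0 < σ) (h1 : σ < 1) :
    ∑' n, (cosMoment f n * σ ^ (n + 1)) ^ 2 ≤
      ∑' n, (cosMoment f n * (1 - σ ^ (n + 1))) ^ 2 := by
  obtain ⟨ρ, -, hρ, hlim⟩ := exists_seq_strictMono_tendsto' h1
  have hρ0 (k : ℕ) : 0 < ρ k := h0.trans (hρ k).1
  have hsum (k : ℕ) := summable_abs_cosMoment_mul_pow hf (hρ0 k) (hρ k).2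
  have hsumσ := summable_abs_cosMoment_mul_pow hf h0 h1
  have hsin {b : ℕ → ℝ} (hb : Summable fun n => |b n|) (x : ℝ) :
      Summable fun n => b n * sin ((n + 1 : ℕ) * arccos x) :=
    Summable.of_norm_bounded hb fun n => by
      rw [norm_mul]
      exact mul_le_of_le_one_right (abs_nonneg _) (abs_sin_le_one _)
  set b : ℕ → ℕ → ℝ := fun k n => cosMoment f n * σ ^ (n + 1) - cosMoment f n * ρ k ^ (n + 1)
    with hb
  have hbs (k : ℕ) : Summable fun n => |b k n| :=
    (hsumσ.add (hsum k)).of_nonneg_of_le (fun _ => abs_nonneg _) fun _ => abs_sub _ _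
  have hint {c : ℕ → ℝ} (hc : Summable fun n => |c n|) :
      Integrable (fun x => (∑' n, c n * sin ((n + 1 : ℕ) * arccos x)) ^ 2) measureT :=
    Polynomial.Chebyshev.integrable_measureT ((continuous_sineSeries hc).pow 2).continuousOn
  have hle : ∫ x, (∑' n, cosMoment f n * σ ^ (n + 1) * sin ((n + 1 : ℕ) * arccos x)) ^ 2 ∂measureT
      ≤ π / 2 * ∑' n, (cosMoment f n * (1 - σ ^ (n + 1))) ^ 2 := by
    refine integral_le_of_ae_tendsto
      (F := fun k x => (∑' n, b k n * sin ((n + 1 : ℕ) * arccos x)) ^ 2)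
      (fun k => hint (hbs k)) (fun _ _ => sq_nonneg _) (hint hsumσ) (fun _ => sq_nonneg _) ?_ ?_
    · refine measureT_absolutelyContinuous.ae_le ?_
      filter_upwards [ae_restrict_mem measurableSet_Ioo, hH,
        ae_tendsto_inv_mul_integral_closedBall hf] with x hx hHx hleb
      have h := ((tendsto_tsum_cosMoment_mul_pow_mul_sin hf hx hleb hHx).comp
        (tendsto_nhdsWithin_iff.2 ⟨hlim, Eventually.of_forall fun k => (hρ k).2⟩)).const_sub
        (∑' n, cosMoment f n * σ ^ (n + 1) * sin ((n + 1 : ℕ) * arccos x))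
      rw [sub_zero] at h
      refine (h.pow 2).congr fun k => ?_
      rw [Function.comp_apply, ← (hsin hsumσ x).tsum_sub (hsin (hsum k) x)]
      simp_rw [hb, sub_mul]
    · refine Eventually.of_forall fun k => ?_
      rw [integral_sineSeries_sq (hbs k)]
      have hterm (n : ℕ) : b k n ^ 2 ≤ (cosMoment f n * (1 - σ ^ (n + 1))) ^ 2 := by
        have h2 : σ ^ (n + 1) ≤ ρ k ^ (n + 1) := pow_le_pow_left₀ h0.le (hρ k).1.le _
        have h3 : ρ k ^ (n + 1) ≤ 1 := pow_le_one₀ (hρ0 k).le (hρ k).2.le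
        simp only [hb]
        rw [← mul_sub, mul_pow, mul_pow, ← neg_sub (ρ k ^ _), neg_sq]
        gcongr
      have hs : Summable fun n => (cosMoment f n * (1 - σ ^ (n + 1))) ^ 2 := by
        refine (summable_cosMoment_sq hf hL2).of_nonneg_of_le (fun _ => sq_nonneg _) fun n => ?_
        have h2 : σ ^ (n + 1) ≤ 1 := pow_le_one₀ h0.le h1.le
        have h3 : 0 < σ ^ (n + 1) := pow_pos h0 _
        rw [mul_pow]
        exact mul_le_of_le_one_right (sq_nonneg _) (pow_le_one₀ (by linarith) (by linarith))
      exact mul_le_mul_of_nonneg_left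
        ((hs.of_nonneg_of_le (fun _ => sq_nonneg _) hterm).tsum_le_tsum hterm hs) (by positivity)
  rw [integral_sineSeries_sq hsumσ] at hle
  exact le_of_mul_le_mul_left hle (by positivity)

lemma cosMoment_eq_zero {f : ℝ → ℝ} (hf : IntegrableOn f (Ioo (-1 : ℝ) 1))
    (hL2 : IntegrableOn (fun x => f x ^ 2 * √(1 - x ^ 2)) (Ioo (-1 : ℝ) 1))
    (hH : ∀ᵐ x ∂(volume.restrict (Ioo (-1 : ℝ) 1)), HasFiniteHilbertAt f x 0) (n : ℕ) :
    cosMoment f n = 0 := by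
  have hsq := summable_cosMoment_sq hf hL2
  have hσ : ∀ᶠ σ in 𝓝[<] (1 : ℝ), 0 < σ ∧ σ < 1 := Ioo_mem_nhdsLT one_pos
  have hlim {φ : ℝ → ℝ} (hφ : Continuous φ)
      (hb : ∀ t, 0 ≤ t → t ≤ 1 → 0 ≤ φ t ∧ φ t ≤ 1) :
      Tendsto (fun σ : ℝ => ∑' n, (cosMoment f n * φ (σ ^ (n + 1))) ^ 2) (𝓝[<] 1)
        (𝓝 (∑' n, (cosMoment f n * φ 1) ^ 2)) := by
    refine tendsto_tsum_of_dominated_convergence hsq (fun n => ?_) ?_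
    · have : Continuous fun σ : ℝ => (cosMoment f n * φ (σ ^ (n + 1))) ^ 2 := by fun_prop
      exact (this.tendsto' _ _ (by simp)).mono_left nhdsWithin_le_nhds
    · filter_upwards [hσ] with σ ⟨h0, h1⟩ n
      obtain ⟨h2, h3⟩ := hb (σ ^ (n + 1)) (by positivity) (pow_le_one₀ h0.le h1.le)
      rw [Real.norm_of_nonneg (sq_nonneg _), mul_pow]
      exact mul_le_of_le_one_right (sq_nonneg _) (pow_le_one₀ h2 h3)
  have hle := le_of_tendsto_of_tendsto (hlim (φ := fun t => t) continuous_id fun t h h' => ⟨h, h'⟩)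
    (hlim (φ := fun t => 1 - t) (by fun_prop) fun t h h' => ⟨by linarith, by linarith⟩) (by
      filter_upwards [hσ] with σ ⟨h0, h1⟩
      exact tsum_cosMoment_sq_mul_le hf hL2 hH h0 h1)
  simp only [mul_one, sub_self, mul_zero, ne_eq, OfNat.ofNat_ne_zero, not_false_eq_true, zero_pow,
    tsum_zero] at hle
  have := (hsq.le_tsum n fun _ _ => sq_nonneg _).trans hle
  exact pow_eq_zero_iff two_ne_zero |>.1 (le_antisymm this (sq_nonneg _))

/-- If `f(x)(1-x²)^{1/4} ∈ L²(-1,1)`, `∫_{-1}^1 f = 0`, and the finite Hilbert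
transform of `f` vanishes a.e. on `(-1,1)`, then `f = 0` a.e. on `(-1,1)`. -/
theorem hilbert_vanishes_mean_zero_implies_zero (f : ℝ → ℝ)
    (hmeas : AEStronglyMeasurable f (volume.restrict (Ioo (-1 : ℝ) 1)))
    (hL2 : IntegrableOn (fun x => f x ^ 2 * Real.sqrt (1 - x ^ 2)) (Ioo (-1 : ℝ) 1))
    (hmean : ∫ x in Ioo (-1 : ℝ) 1, f x = 0)
    (hH : ∀ᵐ x ∂(volume.restrict (Ioo (-1 : ℝ) 1)), HasFiniteHilbertAt f x 0) :
    ∀ᵐ x ∂(volume.restrict (Ioo (-1 : ℝ) 1)), f x = 0 := by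
  have hf := integrable_of_sq_mul_sqrt hmeas hL2
  exact ae_eq_zero_of_integral_mul_eval_eq_zero hf
    (integral_mul_eval_eq_zero hf hmean (cosMoment_eq_zero hf hL2 hH))
end
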